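/- arXiv:1709.04042 — 2 statements merged into one kernel-verified Lean document; each statement's English description precedes it below -/
import Mathlib

section
/- Fix t ∈ (0,1/4). Let β₋,β₊ ∈ (π/4)ℤ with β₋ < 0 < β₊, let I = (β₋,β₊), let α ∈ I ∩ (π/2)ℤ, and set δ = 2(β₊−β₋). Then F^{(α,I)}(t) = (π/(8δ)) · Σ_{σ ∈ (0,δ) ∩ (π/2)ℤ} ( cos(4σα/δ) − cos(4σ(2β₊−α)/δ) ) · F(t, 4σ/δ), a finite sum. -/
open Complex Real Set

noncomputable section

/-- A lattice point `(x,y)` viewed as the complex number `x + iy`. -/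
def ptC (p : ℤ × ℤ) : ℂ := (p.1 : ℂ) + (p.2 : ℂ) * Complex.I

/-- A diagonal step on `ℤ²`. -/
def IsDiagStep (a b : ℤ × ℤ) : Prop :=
  b - a = (1, 1) ∨ b - a = (1, -1) ∨ b - a = (-1, -1) ∨ b - a = (-1, 1)

/-- A rectilinear step on `ℤ²`. -/
def IsRectStep (a b : ℤ × ℤ) : Prop :=
  b - a = (1, 0) ∨ b - a = (-1, 0) ∨ b - a = (0, 1) ∨ b - a = (0, -1)

/-- `w` encodes a simple diagonal walk `(w₀, …, w_n)` as a list of length `n+1`. -/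
def IsWalkList (w : List (ℤ × ℤ)) : Prop := w ≠ [] ∧ w.Chain' IsDiagStep

/-- Winding angle of the walk `w` around the origin up to time `i`. -/
def windTo (w : List (ℤ × ℤ)) (i : ℕ) : ℝ :=
  ∑ j ∈ Finset.range i, (ptC (w.getD (j + 1) 0) / ptC (w.getD j 0)).arg

/-- The full winding angle of the walk `w` around the origin. -/
def wind (w : List (ℤ × ℤ)) : ℝ := windTo w (w.length - 1)

/-- The condition on walks counted by `W^{(α,I)}_{l,p}`: a simple diagonal walk on
`ℤ² ∖ {0}` from `(p,0)` to a point on one of the axes at distance `l` from the origin,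
with full winding angle `α` and intermediate winding angles in `I`. -/
def WCond (l p : ℕ) (α : ℝ) (I : Set ℝ) (w : List (ℤ × ℤ)) : Prop :=
  IsWalkList w ∧ (∀ x ∈ w, x ≠ (0, 0)) ∧ w.head? = some ((p : ℤ), 0) ∧
    (w.getLast? = some ((l : ℤ), 0) ∨ w.getLast? = some (-(l : ℤ), 0) ∨
      w.getLast? = some (0, (l : ℤ)) ∨ w.getLast? = some (0, -(l : ℤ))) ∧
    wind w = α ∧ (∀ i, 1 ≤ i → i ≤ w.length - 2 → windTo w i ∈ I)

/-- The generating function `W^{(α,I)}_{l,p}(t)`. -/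
def Wgen (t : ℝ) (l p : ℕ) (α : ℝ) (I : Set ℝ) : ℝ :=
  ∑' w : {w : List (ℤ × ℤ) // WCond l p α I w}, t ^ (w.val.length - 1)

/-- The complete elliptic integral of the first kind `K(k)`. -/
def Kell (k : ℝ) : ℝ := ∫ y in (0:ℝ)..1, 1 / Real.sqrt ((1 - y ^ 2) * (1 - k ^ 2 * y ^ 2))

/-- The complete elliptic integral of the second kind `E(k)`. -/
def Eell (k : ℝ) : ℝ := ∫ y in (0:ℝ)..1, Real.sqrt (1 - k ^ 2 * y ^ 2) / Real.sqrt (1 - y ^ 2)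

/-- The complementary modulus `k' = √(1-k²)`. -/
def kComp (k : ℝ) : ℝ := Real.sqrt (1 - k ^ 2)

/-- The elliptic nome `q_k = exp(-π K(k')/K(k))`. -/
def qNome (k : ℝ) : ℝ := Real.exp (-π * Kell (kComp k) / Kell k)

/-- The descending Landen transformation `k₁ = (1-k')/(1+k')`. -/
def kLanden (k : ℝ) : ℝ := (1 - kComp k) / (1 + kComp k)

/-- `T_k = K(k')/(4K(k))`. -/
def Tell (k : ℝ) : ℝ := Kell (kComp k) / (4 * Kell k)

/-- The plane minus the two real slits `{z ∈ ℝ : z² ≥ κ}`. -/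
def slitDom (κ : ℝ) : Set ℂ := {z : ℂ | ¬(z.im = 0 ∧ κ ≤ z.re ^ 2)}

/-- `v` is the analytic function `v_κ` on `ℂ ∖ {z ∈ ℝ : z² ≥ κ}` with `v 0 = 0` and
`v'(z) = 1/(4K(κ)√((κ-z²)(1-κz²)))`, the branch of the square root being positive on
`(-√κ, √κ)` (by analytic continuation this determines `v` uniquely). -/
structure IsVmap (κ : ℝ) (v : ℂ → ℂ) : Prop where
  map_zero : v 0 = 0
  analytic : AnalyticOnNhd ℂ v (slitDom κ)
  deriv_real : ∀ x : ℝ, x ^ 2 < κ →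
    HasDerivAt v ((1 / (4 * Kell κ * Real.sqrt ((κ - x ^ 2) * (1 - κ * x ^ 2))) : ℝ) : ℂ)
      (x : ℂ)

/-- The function `f_m(z) = cos(2πm(v(z) + 1/4)) - cos(πm/2)` built from `v = v_{k₁}`. -/
def fmFun (v : ℂ → ℂ) (m : ℕ) (z : ℂ) : ℂ :=
  Complex.cos (2 * (π : ℂ) * m * (v z + 1 / 4)) - Complex.cos ((π : ℂ) * m / 2)

/-- `a n m` is the (real) Taylor coefficient `[zⁿ] f_m(z)` at `0`. -/
def IsCoeff (κ : ℝ) (v : ℂ → ℂ) (a : ℕ → ℕ → ℝ) : Prop :=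
  ∀ m : ℕ, 1 ≤ m → ∀ z : ℂ, z ∈ slitDom κ → ‖z‖ < 1 →
    HasSum (fun n : ℕ => (a n m : ℂ) * z ^ n) (fmFun v m z)

/-- An excursion: a nonempty simple diagonal walk from the origin to the origin with no
intermediate visits to the origin. -/
def IsExcursion (w : List (ℤ × ℤ)) : Prop :=
  2 ≤ w.length ∧ w.Chain' IsDiagStep ∧ w.head? = some (0, 0) ∧ w.getLast? = some (0, 0) ∧
    ∀ i, 1 ≤ i → i ≤ w.length - 2 → w.getD i 0 ≠ (0, 0)

/-- The winding angle sequence of an excursion: `θ₀ = θ₁ = 0`, increments of the first and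
last step do not contribute, and `θ_n = θ_{n-1}`. -/
def windExcTo (w : List (ℤ × ℤ)) (i : ℕ) : ℝ :=
  ∑ j ∈ Finset.Icc 2 (min i (w.length - 2)), (ptC (w.getD j 0) / ptC (w.getD (j - 1) 0)).arg

/-- The full winding angle of an excursion. -/
def windExc (w : List (ℤ × ℤ)) : ℝ := windExcTo w (w.length - 1)

/-- `F^{(α)}(t)`: generating function of excursions with winding angle `α`. -/
def Fgen (t α : ℝ) : ℝ :=
  ∑' w : {w : List (ℤ × ℤ) // IsExcursion w ∧ windExc w = α}, t ^ (w.val.length - 1)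

/-- `F(t,b) = Σ_w t^{|w|} e^{i b θ^w}`, the characteristic function of excursions. -/
def Fchar (t b : ℝ) : ℂ :=
  ∑' w : {w : List (ℤ × ℤ) // IsExcursion w},
    (t : ℂ) ^ (w.val.length - 1) * Complex.exp (Complex.I * b * windExc w.val)

/-- `ψ_k(z) = (1 - √(1-kz²))/(√k z)` (principal square root), `ψ_k(0) = 0`. -/
def psiK (k : ℝ) (z : ℂ) : ℂ :=
  if z = 0 then 0 else (1 - (1 - (k : ℂ) * z ^ 2) ^ ((1 : ℂ) / 2)) / ((Real.sqrt k : ℂ) * z)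

/-- `F^{(α,I)}(t)`: generating function of excursions with first step `(1,1)`, winding
angle `α`, and winding angle sequence in `I`. -/
def FgenI (t α : ℝ) (I : Set ℝ) : ℝ :=
  ∑' w : {w : List (ℤ × ℤ) // IsExcursion w ∧ w.getD 1 0 = (1, 1) ∧ windExc w = α ∧
      ∀ i ≤ w.length - 1, windExcTo w i ∈ I},
    t ^ (w.val.length - 1)

/-! ### Lattice symmetries -/

lemma ptC_re (p : ℤ × ℤ) : (ptC p).re = p.1 := by simp [ptC]

lemma ptC_im (p : ℤ × ℤ) : (ptC p).im = p.2 := by simp [ptC]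

lemma ptC_ne_zero {p : ℤ × ℤ} (hp : p ≠ 0) : ptC p ≠ 0 := by
  intro h
  apply hp
  have h1 := ptC_re p
  have h2 := ptC_im p
  rw [h] at h1 h2
  ext
  · exact_mod_cast h1.symm
  · exact_mod_cast h2.symm

lemma isDiagStep_iff (p q : ℤ × ℤ) :
    IsDiagStep p q ↔ (q.1 = p.1 + 1 ∨ q.1 = p.1 - 1) ∧ (q.2 = p.2 + 1 ∨ q.2 = p.2 - 1) := by
  simp only [IsDiagStep, Prod.ext_iff, Prod.fst_sub, Prod.snd_sub]
  omega

/-- The cosine of `(π/2)(1+k)`. -/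
def quarterCos (k : ℤ) : ℤ := if k % 4 = 1 then -1 else if k % 4 = 3 then 1 else 0

/-- The sine of `(π/2)(1+k)`. -/
def quarterSin (k : ℤ) : ℤ := if k % 4 = 0 then 1 else if k % 4 = 2 then -1 else 0

lemma quarter_cases (k : ℤ) :
    (quarterCos k = 0 ∧ quarterSin k = 1) ∨ (quarterCos k = -1 ∧ quarterSin k = 0) ∨
      (quarterCos k = 0 ∧ quarterSin k = -1) ∨ (quarterCos k = 1 ∧ quarterSin k = 0) := by
  unfold quarterCos quarterSin
  have : k % 4 = 0 ∨ k % 4 = 1 ∨ k % 4 = 2 ∨ k % 4 = 3 := by omega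
  rcases this with h | h | h | h <;> simp [h]

lemma quarter_trig (k : ℤ) :
    (quarterCos k : ℝ) = Real.cos (π / 2 * (1 + k)) ∧
      (quarterSin k : ℝ) = Real.sin (π / 2 * (1 + k)) := by
  have hk : (k : ℝ) = 4 * (k / 4 : ℤ) + (k % 4 : ℤ) := by
    exact_mod_cast (Int.mul_ediv_add_emod k 4).symm
  have hr : π / 2 * (1 + k) = π / 2 * (1 + (k % 4 : ℤ)) + (k / 4 : ℤ) * (2 * π) := by
    rw [hk]; ring
  rw [hr, Real.cos_add_int_mul_two_pi, Real.sin_add_int_mul_two_pi]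
  unfold quarterCos quarterSin
  have : k % 4 = 0 ∨ k % 4 = 1 ∨ k % 4 = 2 ∨ k % 4 = 3 := by omega
  rcases this with h | h | h | h <;> simp only [h]
  · norm_num
  · norm_num
  · have : π / 2 * (1 + ((2 : ℤ) : ℝ)) = π / 2 + π := by push_cast; ring
    rw [this]; norm_num [Real.cos_add_pi, Real.sin_add_pi]
  · have : π / 2 * (1 + ((3 : ℤ) : ℝ)) = 2 * π := by push_cast; ring
    rw [this]; norm_num

/-- The reflection of `ℤ²` in the line through the origin at angle `(π/4)(1+k)`. -/
def axisReflection (k : ℤ) : (ℤ × ℤ) ≃+ (ℤ × ℤ) where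
  toFun p := (quarterCos k * p.1 + quarterSin k * p.2, quarterSin k * p.1 - quarterCos k * p.2)
  invFun p := (quarterCos k * p.1 + quarterSin k * p.2, quarterSin k * p.1 - quarterCos k * p.2)
  left_inv p := by
    rcases quarter_cases k with ⟨h, h'⟩ | ⟨h, h'⟩ | ⟨h, h'⟩ | ⟨h, h'⟩ <;> simp [h, h']
  right_inv p := by
    rcases quarter_cases k with ⟨h, h'⟩ | ⟨h, h'⟩ | ⟨h, h'⟩ | ⟨h, h'⟩ <;> simp [h, h']
  map_add' p q := by ext <;> simp <;> ring

lemma axisReflection_apply (k : ℤ) (p : ℤ × ℤ) : axisReflection k p =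
    (quarterCos k * p.1 + quarterSin k * p.2, quarterSin k * p.1 - quarterCos k * p.2) := rfl

/-- The rotation of `ℤ²` by a right angle. -/
def quarterTurn : (ℤ × ℤ) ≃+ (ℤ × ℤ) where
  toFun p := (-p.2, p.1)
  invFun p := (p.2, -p.1)
  left_inv p := by simp
  right_inv p := by simp
  map_add' p q := by ext <;> simp; ring

lemma quarterTurn_apply (p : ℤ × ℤ) : quarterTurn p = (-p.2, p.1) := rfl

lemma quarterTurn_symm_apply (p : ℤ × ℤ) : quarterTurn.symm p = (p.2, -p.1) := rfl

lemma isDiagStep_axisReflection (k : ℤ) {p q : ℤ × ℤ} (h : IsDiagStep p q) :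
    IsDiagStep (axisReflection k p) (axisReflection k q) := by
  rw [isDiagStep_iff] at h ⊢
  rcases quarter_cases k with ⟨h1, h2⟩ | ⟨h1, h2⟩ | ⟨h1, h2⟩ | ⟨h1, h2⟩ <;>
    simp only [axisReflection_apply, h1, h2] <;> omega

lemma isDiagStep_quarterTurn {p q : ℤ × ℤ} (h : IsDiagStep p q) :
    IsDiagStep (quarterTurn p) (quarterTurn q) := by
  rw [isDiagStep_iff] at h ⊢
  simp only [quarterTurn_apply]
  omega

lemma isDiagStep_quarterTurn_symm {p q : ℤ × ℤ} (h : IsDiagStep p q) :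
    IsDiagStep (quarterTurn.symm p) (quarterTurn.symm q) := by
  rw [isDiagStep_iff] at h ⊢
  simp only [quarterTurn_symm_apply]
  omega

lemma mul_nonneg_of_adjacent {a b : ℤ} (h : b = a + 1 ∨ b = a - 1) : 0 ≤ a * b := by
  rcases h with rfl | rfl
  · rcases le_or_gt 0 a with h | h <;> nlinarith
  · rcases le_or_gt a 0 with h | h <;> nlinarith

lemma mul_nonneg_of_even_adjacent {a b : ℤ} (ha : Even a) (h : b = a ∨ b = a + 2 ∨ b = a - 2) :
    0 ≤ a * b := by
  obtain ⟨c, rfl⟩ := ha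
  rcases h with rfl | rfl | rfl
  · nlinarith
  · have := mul_nonneg_of_adjacent (Or.inl (rfl : c + 1 = c + 1)); nlinarith
  · have := mul_nonneg_of_adjacent (Or.inr (rfl : c - 1 = c - 1)); nlinarith

lemma IsDiagStep.abs_arg_le {p q : ℤ × ℤ} (h : IsDiagStep p q) :
    |(ptC q / ptC p).arg| ≤ π / 2 := by
  rw [Complex.abs_arg_le_pi_div_two_iff, Complex.div_re, ptC_re, ptC_re, ptC_im, ptC_im]
  rw [isDiagStep_iff] at h
  have h1 : (0 : ℝ) ≤ p.1 * q.1 := by exact_mod_cast mul_nonneg_of_adjacent h.1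
  have h2 : (0 : ℝ) ≤ p.2 * q.2 := by exact_mod_cast mul_nonneg_of_adjacent h.2
  have := Complex.normSq_nonneg (ptC p)
  rw [← add_div]
  exact div_nonneg (by linarith) this

lemma arg_axisReflection (k : ℤ) {p q : ℤ × ℤ} (h : IsDiagStep p q) :
    (ptC (axisReflection k q) / ptC (axisReflection k p)).arg = -(ptC q / ptC p).arg := by
  have key : ∀ p : ℤ × ℤ, ptC (axisReflection k p) =
      ((quarterCos k : ℂ) + quarterSin k * I) * (starRingEnd ℂ) (ptC p) := by
    intro p
    apply Complex.ext
    · simp [ptC, axisReflection_apply]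
    · simp [ptC, axisReflection_apply]
      ring
  have hne : (quarterCos k : ℂ) + quarterSin k * I ≠ 0 := by
    rcases quarter_cases k with ⟨h1, h2⟩ | ⟨h1, h2⟩ | ⟨h1, h2⟩ | ⟨h1, h2⟩ <;> simp [h1, h2]
  rw [key, key, mul_div_mul_left _ _ hne, ← map_div₀, Complex.arg_conj, if_neg]
  intro h'
  have := h.abs_arg_le
  rw [h', abs_of_pos Real.pi_pos] at this
  linarith [Real.pi_pos]

lemma arg_quarterTurn (p q : ℤ × ℤ) :
    (ptC (quarterTurn q) / ptC (quarterTurn p)).arg = (ptC q / ptC p).arg := by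
  have key : ∀ p : ℤ × ℤ, ptC (quarterTurn p) = I * ptC p := by
    intro p
    apply Complex.ext <;> simp [ptC, quarterTurn_apply]
  rw [key, key, mul_div_mul_left _ _ Complex.I_ne_zero]

/-- A diagonal step between points of the even sublattice does not cross a ray
at angle `(π/4)(1+k)` transversally. -/
lemma IsDiagStep.reflection_form_nonneg {p q : ℤ × ℤ} (h : IsDiagStep p q)
    (hp : Even (p.1 + p.2)) (k : ℤ) :
    0 ≤ (p.1 * q.1 + p.2 * q.2) + quarterCos k * (p.2 * q.2 - p.1 * q.1)
      - quarterSin k * (p.1 * q.2 + q.1 * p.2) := by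
  rw [isDiagStep_iff] at h
  have h1 := mul_nonneg_of_adjacent h.1
  have h2 := mul_nonneg_of_adjacent h.2
  have h3 : 0 ≤ (p.1 + p.2) * (q.1 + q.2) := mul_nonneg_of_even_adjacent hp (by omega)
  have h4 : 0 ≤ (p.1 - p.2) * (q.1 - q.2) :=
    mul_nonneg_of_even_adjacent (by rw [Int.even_sub]; rwa [Int.even_add] at hp) (by omega)
  rcases quarter_cases k with ⟨h1, h2⟩ | ⟨h1, h2⟩ | ⟨h1, h2⟩ | ⟨h1, h2⟩ <;> rw [h1, h2] <;>
    nlinarith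

/-! ### Excursions and their winding angles -/

lemma isExcursion_iff (w : List (ℤ × ℤ)) : IsExcursion w ↔ 2 ≤ w.length ∧
    (∀ i, i + 1 < w.length → IsDiagStep (w.getD i 0) (w.getD (i + 1) 0)) ∧
    w.getD 0 0 = 0 ∧ w.getD (w.length - 1) 0 = 0 ∧
    ∀ i, 1 ≤ i → i ≤ w.length - 2 → w.getD i 0 ≠ 0 := by
  unfold IsExcursion
  refine and_congr_right fun hlen => ?_
  refine and_congr ?_ (and_congr ?_ (and_congr ?_ Iff.rfl))
  · refine List.isChain_iff_getElem.trans ?_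
    refine forall_congr' fun i => ⟨fun h hi => ?_, fun h hi => ?_⟩
    · rw [List.getD_eq_getElem _ _ hi, List.getD_eq_getElem _ _ (by omega)]
      exact h hi
    · have := h hi
      rwa [List.getD_eq_getElem _ _ hi, List.getD_eq_getElem _ _ (by omega)] at this
  · rw [List.head?_eq_getElem?, List.getD_eq_getElem _ _ (by omega),
      List.getElem?_eq_getElem (by omega), Option.some_inj]
    rfl
  · rw [List.getLast?_eq_getElem?, List.getD_eq_getElem _ _ (by omega),
      List.getElem?_eq_getElem (by omega), Option.some_inj]
    rfl

lemma windExcTo_zero (w : List (ℤ × ℤ)) : windExcTo w 0 = 0 := by simp [windExcTo]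

lemma windExcTo_one (w : List (ℤ × ℤ)) : windExcTo w 1 = 0 := by
  rw [windExcTo, Finset.Icc_eq_empty (by omega), Finset.sum_empty]

lemma windExcTo_min (w : List (ℤ × ℤ)) (i : ℕ) :
    windExcTo w (min i (w.length - 2)) = windExcTo w i := by
  simp [windExcTo]

lemma windExc_eq (w : List (ℤ × ℤ)) : windExc w = windExcTo w (w.length - 2) := by
  rw [windExc, ← windExcTo_min, min_eq_right (by omega)]

lemma IsExcursion.windExcTo_succ {w : List (ℤ × ℤ)} (hw : IsExcursion w) {i : ℕ}
    (hi : i + 1 ≤ w.length - 2) :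
    windExcTo w (i + 1) = windExcTo w i + (ptC (w.getD (i + 1) 0) / ptC (w.getD i 0)).arg := by
  rcases Nat.eq_zero_or_pos i with rfl | h
  · rw [isExcursion_iff] at hw
    rw [windExcTo_zero, zero_add, windExcTo_one, hw.2.2.1]
    simp [ptC]
  · rw [windExcTo, windExcTo, min_eq_left hi, min_eq_left (by omega),
      Finset.sum_Icc_succ_top (by omega)]
    simp

lemma IsExcursion.even_getD {w : List (ℤ × ℤ)} (hw : IsExcursion w) {i : ℕ}
    (hi : i < w.length) : Even ((w.getD i 0).1 + (w.getD i 0).2) := by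
  rw [isExcursion_iff] at hw
  induction i with
  | zero => rw [hw.2.2.1]; exact Even.zero
  | succ i ih =>
    have h := hw.2.1 i hi
    rw [isDiagStep_iff] at h
    have := ih (by omega)
    rw [Int.even_iff] at this ⊢
    omega

/-- Polar coordinates of an excursion in terms of its winding angle sequence. -/
lemma IsExcursion.ptC_getD {w : List (ℤ × ℤ)} (hw : IsExcursion w) (h1 : w.getD 1 0 = (1, 1))
    {i : ℕ} (hi : 1 ≤ i) (hi' : i ≤ w.length - 2) :
    ptC (w.getD i 0) = ‖ptC (w.getD i 0)‖ * Complex.exp ((π / 4 + windExcTo w i : ℝ) * I) := by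
  induction i, hi using Nat.le_induction with
  | base =>
    rw [h1, windExcTo_one, add_zero]
    have harg : (ptC (1, 1)).arg = π / 4 := by
      have : ptC (1, 1) = (Real.sqrt 2 : ℝ) *
          (Complex.cos (π / 4 : ℝ) + Complex.sin (π / 4 : ℝ) * I) := by
        rw [← Complex.ofReal_cos, ← Complex.ofReal_sin, Real.cos_pi_div_four,
          Real.sin_pi_div_four]
        have h2 : Real.sqrt 2 * Real.sqrt 2 = 2 := Real.mul_self_sqrt (by norm_num)
        apply Complex.ext <;> simp [ptC, -Complex.ofReal_div] <;> nlinarith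
      rw [this]
      exact Complex.arg_mul_cos_add_sin_mul_I (by positivity)
        ⟨by linarith [Real.pi_pos], by linarith [Real.pi_pos]⟩
    rw [← harg, Complex.norm_mul_exp_arg_mul_I]
  | succ i hi ih =>
    have ih := ih (by omega)
    have hne : ptC (w.getD i 0) ≠ 0 :=
      ptC_ne_zero (((isExcursion_iff w).1 hw).2.2.2.2 i hi (by omega))
    rw [hw.windExcTo_succ hi']
    have h := Complex.norm_mul_exp_arg_mul_I (ptC (w.getD (i + 1) 0) / ptC (w.getD i 0))
    have hn : (‖ptC (w.getD i 0)‖ : ℂ) ≠ 0 := by simpa using hne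
    calc ptC (w.getD (i + 1) 0)
        = ptC (w.getD i 0) * (ptC (w.getD (i + 1) 0) / ptC (w.getD i 0)) := by field_simp
      _ = (‖ptC (w.getD i 0)‖ * Complex.exp ((π / 4 + windExcTo w i : ℝ) * I)) *
          (‖ptC (w.getD (i + 1) 0) / ptC (w.getD i 0)‖ *
            Complex.exp ((ptC (w.getD (i + 1) 0) / ptC (w.getD i 0)).arg * I)) := by
          rw [h, ← ih]
      _ = _ := by
          rw [norm_div]
          push_cast
          rw [← add_assoc, add_mul _ (((ptC (w.getD (i + 1) 0) / ptC (w.getD i 0)).arg : ℝ) : ℂ),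
            Complex.exp_add]
          field_simp

lemma IsExcursion.getD_re_im {w : List (ℤ × ℤ)} (hw : IsExcursion w) (h1 : w.getD 1 0 = (1, 1))
    {i : ℕ} (hi : 1 ≤ i) (hi' : i ≤ w.length - 2) :
    0 < ‖ptC (w.getD i 0)‖ ∧
    ((w.getD i 0).1 : ℝ) = ‖ptC (w.getD i 0)‖ * Real.cos (π / 4 + windExcTo w i) ∧
    ((w.getD i 0).2 : ℝ) = ‖ptC (w.getD i 0)‖ * Real.sin (π / 4 + windExcTo w i) := by
  have h := hw.ptC_getD h1 hi hi'
  refine ⟨norm_pos_iff.2 (ptC_ne_zero (((isExcursion_iff w).1 hw).2.2.2.2 i hi hi')), ?_, ?_⟩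
  · rw [← ptC_re, h, Complex.re_ofReal_mul, Complex.exp_ofReal_mul_I_re, ← h]
  · rw [← ptC_im, h, Complex.im_ofReal_mul, Complex.exp_ofReal_mul_I_im, ← h]

lemma IsExcursion.axisReflection_getD {w : List (ℤ × ℤ)} (hw : IsExcursion w)
    (h1 : w.getD 1 0 = (1, 1)) {i : ℕ} (hi : 1 ≤ i) (hi' : i ≤ w.length - 2) {k : ℤ}
    (hk : windExcTo w i = π / 4 * k) : axisReflection k (w.getD i 0) = w.getD i 0 := by
  obtain ⟨-, hx, hy⟩ := hw.getD_re_im h1 hi hi'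
  obtain ⟨hc, hs⟩ := quarter_trig k
  have e : π / 4 + windExcTo w i = π / 2 * (1 + k) - (π / 4 + windExcTo w i) := by
    rw [hk]; ring
  have hcos := congrArg Real.cos e
  have hsin := congrArg Real.sin e
  rw [Real.cos_sub, ← hc, ← hs] at hcos
  rw [Real.sin_sub, ← hc, ← hs] at hsin
  rw [axisReflection_apply]
  ext
  · have : (quarterCos k * (w.getD i 0).1 + quarterSin k * (w.getD i 0).2 : ℝ) =
        (w.getD i 0).1 := by
      rw [hx, hy]; linear_combination (-‖ptC (w.getD i 0)‖) * hcos
    exact_mod_cast this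
  · have : (quarterSin k * (w.getD i 0).1 - quarterCos k * (w.getD i 0).2 : ℝ) =
        (w.getD i 0).2 := by
      rw [hx, hy]; linear_combination (-‖ptC (w.getD i 0)‖) * hsin
    exact_mod_cast this

lemma sin_mul_sin_neg {a b : ℝ} (hab : a * b < 0) (h : |a - b| ≤ π / 2) :
    Real.sin a * Real.sin b < 0 := by
  rw [abs_le] at h
  have := Real.pi_pos
  rcases mul_neg_iff.1 hab with ⟨ha, hb⟩ | ⟨ha, hb⟩
  · exact mul_neg_of_pos_of_neg (Real.sin_pos_of_pos_of_lt_pi ha (by linarith))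
      (Real.sin_neg_of_neg_of_neg_pi_lt hb (by linarith))
  · exact mul_neg_of_neg_of_pos (Real.sin_neg_of_neg_of_neg_pi_lt ha (by linarith))
      (Real.sin_pos_of_pos_of_lt_pi hb (by linarith))

/-- The winding angle sequence cannot jump over a multiple of `π/4`. -/
lemma IsExcursion.windExcTo_no_jump {w : List (ℤ × ℤ)} (hw : IsExcursion w)
    (h1 : w.getD 1 0 = (1, 1)) {i : ℕ} (hi : 1 ≤ i) (hi' : i + 1 ≤ w.length - 2) (k : ℤ) :
    0 ≤ (windExcTo w i - π / 4 * k) * (windExcTo w (i + 1) - π / 4 * k) := by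
  by_contra! hneg
  obtain ⟨hr, hx, hy⟩ := hw.getD_re_im h1 hi (by omega)
  obtain ⟨hr', hx', hy'⟩ := hw.getD_re_im h1 (i := i + 1) (by omega) hi'
  have hstep := ((isExcursion_iff w).1 hw).2.1 i (by omega)
  have hform := Int.cast_nonneg (R := ℝ) (hstep.reflection_form_nonneg (hw.even_getD (by omega)) k)
  have hsin := sin_mul_sin_neg hneg (by
    have := hstep.abs_arg_le
    rw [abs_sub_comm]
    rwa [hw.windExcTo_succ hi', sub_sub_sub_cancel_right, add_sub_cancel_left])
  obtain ⟨hc, hs⟩ := quarter_trig k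
  push_cast at hform
  rw [hc, hs, hx, hy, hx', hy'] at hform
  set A := π / 4 + windExcTo w i with hA
  set A' := π / 4 + windExcTo w (i + 1) with hA'
  set B := π / 4 * (1 + (k : ℝ)) with hB
  have e1 : windExcTo w i - π / 4 * k = A - B := by rw [hA, hB]; ring
  have e2 : windExcTo w (i + 1) - π / 4 * k = A' - B := by rw [hA', hB]; ring
  have e3 : π / 2 * (1 + (k : ℝ)) = 2 * B := by rw [hB]; ring
  rw [e1, e2, Real.sin_sub, Real.sin_sub] at hsin
  rw [e3, Real.cos_two_mul, Real.sin_two_mul] at hform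
  have hsq := Real.sin_sq_add_cos_sq B
  have := mul_neg_of_pos_of_neg (mul_pos hr hr') hsin
  have hX := congrArg (‖ptC (w.getD i 0)‖ * Real.cos A *
    (‖ptC (w.getD (i + 1) 0)‖ * Real.cos A') * ·) hsq
  beta_reduce at hX
  linarith

/-- The total winding angle of an excursion is a multiple of `π/2`. -/
lemma IsExcursion.exists_windExc {w : List (ℤ × ℤ)} (hw : IsExcursion w)
    (h1 : w.getD 1 0 = (1, 1)) : ∃ k : ℤ, windExc w = π / 2 * k := by
  have hw' := (isExcursion_iff w).1 hw
  have hlen : 1 ≤ w.length - 2 := by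
    by_contra! h
    have h2 : w.length - 1 = 1 := by omega
    have := hw'.2.2.2.1
    rw [h2, h1] at this
    simp at this
  have hstep := hw'.2.1 (w.length - 2) (by omega)
  rw [show w.length - 2 + 1 = w.length - 1 by omega, hw'.2.2.2.1, isDiagStep_iff] at hstep
  obtain ⟨hr, hx, hy⟩ := hw.getD_re_im h1 hlen le_rfl
  rw [← windExc_eq] at hx hy
  have hsq : (w.getD (w.length - 2) 0).1 ^ 2 = (w.getD (w.length - 2) 0).2 ^ 2 := by
    obtain ⟨hx, hy⟩ := hstep
    simp only [Prod.fst_zero, Prod.snd_zero] at hx hy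
    rw [sq_eq_sq_iff_eq_or_eq_neg]
    omega
  have hsq' : ((w.getD (w.length - 2) 0).1 : ℝ) ^ 2 = ((w.getD (w.length - 2) 0).2 : ℝ) ^ 2 := by
    exact_mod_cast hsq
  rw [hx, hy, mul_pow, mul_pow, mul_right_inj' (by positivity)] at hsq'
  have hsin : Real.sin (2 * windExc w) = 0 := by
    have h := Real.cos_two_mul' (π / 4 + windExc w)
    rw [show 2 * (π / 4 + windExc w) = 2 * windExc w + π / 2 by ring, Real.cos_add_pi_div_two]
      at h
    linarith
  obtain ⟨n, hn⟩ := Real.sin_eq_zero_iff.1 hsin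
  exact ⟨n, by linarith⟩

/-! ### Transforming the tail of a walk -/

/-- Apply the map `M` to all points of the walk `w` after time `τ`. -/
def tailMap (M : (ℤ × ℤ) ≃+ (ℤ × ℤ)) (τ : ℕ) (w : List (ℤ × ℤ)) : List (ℤ × ℤ) :=
  w.mapIdx fun i p => if i ≤ τ then p else M p

lemma length_tailMap (M : (ℤ × ℤ) ≃+ (ℤ × ℤ)) (τ : ℕ) (w : List (ℤ × ℤ)) :
    (tailMap M τ w).length = w.length := List.length_mapIdx

lemma getD_tailMap (M : (ℤ × ℤ) ≃+ (ℤ × ℤ)) (τ : ℕ) (w : List (ℤ × ℤ)) (i : ℕ) :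
    (tailMap M τ w).getD i 0 = if i ≤ τ then w.getD i 0 else M (w.getD i 0) := by
  rw [List.getD_eq_getElem?_getD, List.getD_eq_getElem?_getD, tailMap, List.getElem?_mapIdx]
  cases w[i]? <;> simp

lemma getD_tailMap_of_le (M : (ℤ × ℤ) ≃+ (ℤ × ℤ)) {τ i : ℕ} (w : List (ℤ × ℤ)) (h : i ≤ τ) :
    (tailMap M τ w).getD i 0 = w.getD i 0 := by
  rw [getD_tailMap, if_pos h]

lemma getD_tailMap_of_ge {M : (ℤ × ℤ) ≃+ (ℤ × ℤ)} {τ i : ℕ} {w : List (ℤ × ℤ)}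
    (hfix : M (w.getD τ 0) = w.getD τ 0) (h : τ ≤ i) :
    (tailMap M τ w).getD i 0 = M (w.getD i 0) := by
  rw [getD_tailMap]
  split_ifs with h'
  · rw [le_antisymm h' h, hfix]
  · rfl

lemma tailMap_symm_tailMap (M : (ℤ × ℤ) ≃+ (ℤ × ℤ)) (τ : ℕ) (w : List (ℤ × ℤ)) :
    tailMap M.symm τ (tailMap M τ w) = w := by
  refine List.ext_getElem? fun i => ?_
  rw [tailMap, tailMap, List.getElem?_mapIdx, List.getElem?_mapIdx]
  cases w[i]? with
  | none => rfl
  | some p =>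
    by_cases h : i ≤ τ <;> simp [h]

lemma isExcursion_tailMap {w : List (ℤ × ℤ)} (hw : IsExcursion w) {M : (ℤ × ℤ) ≃+ (ℤ × ℤ)}
    (hM : ∀ {p q}, IsDiagStep p q → IsDiagStep (M p) (M q)) {τ : ℕ}
    (hfix : M (w.getD τ 0) = w.getD τ 0) : IsExcursion (tailMap M τ w) := by
  rw [isExcursion_iff] at hw ⊢
  obtain ⟨hlen, hstep, h0, hlast, hne⟩ := hw
  rw [length_tailMap]
  refine ⟨hlen, fun i hi => ?_, ?_, ?_, fun i hi hi' => ?_⟩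
  · rcases lt_or_ge i τ with h | h
    · rw [getD_tailMap_of_le _ _ h.le, getD_tailMap_of_le _ _ h]
      exact hstep i hi
    · rw [getD_tailMap_of_ge hfix h, getD_tailMap_of_ge hfix (by omega)]
      exact hM (hstep i hi)
  · rw [getD_tailMap_of_le _ _ (Nat.zero_le τ), h0]
  · rw [getD_tailMap, hlast]; simp
  · rw [getD_tailMap]
    have := hne i hi hi'
    split_ifs <;> simpa using this

lemma windExcTo_tailMap_of_le {w : List (ℤ × ℤ)} (hw : IsExcursion w)
    {M : (ℤ × ℤ) ≃+ (ℤ × ℤ)} (hM : ∀ {p q}, IsDiagStep p q → IsDiagStep (M p) (M q)) {τ : ℕ}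
    (hfix : M (w.getD τ 0) = w.getD τ 0) (hτ : τ ≤ w.length - 2) {i : ℕ} (hi : i ≤ τ) :
    windExcTo (tailMap M τ w) i = windExcTo w i := by
  induction i with
  | zero => simp [windExcTo_zero]
  | succ i ih =>
    rw [(isExcursion_tailMap hw hM hfix).windExcTo_succ (by rw [length_tailMap]; omega),
      hw.windExcTo_succ (by omega), ih (by omega), getD_tailMap_of_le _ _ hi,
      getD_tailMap_of_le _ _ (by omega)]

lemma windExcTo_tailMap_of_ge {w : List (ℤ × ℤ)} (hw : IsExcursion w)
    {M : (ℤ × ℤ) ≃+ (ℤ × ℤ)} (hM : ∀ {p q}, IsDiagStep p q → IsDiagStep (M p) (M q)) {ε : ℝ}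
    (hε : ∀ {p q}, IsDiagStep p q → (ptC (M q) / ptC (M p)).arg = ε * (ptC q / ptC p).arg)
    {τ : ℕ} (hfix : M (w.getD τ 0) = w.getD τ 0) (hτ : τ ≤ w.length - 2) {i : ℕ} (hi : τ ≤ i) :
    windExcTo (tailMap M τ w) i =
      windExcTo w τ + ε * (windExcTo w i - windExcTo w τ) := by
  suffices H : ∀ j, τ ≤ j → j ≤ w.length - 2 → windExcTo (tailMap M τ w) j =
      windExcTo w τ + ε * (windExcTo w j - windExcTo w τ) by
    rw [← windExcTo_min w i, ← windExcTo_min _ i, length_tailMap]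
    exact H _ (le_min hi hτ) (min_le_right _ _)
  intro j hj hj'
  induction j, hj using Nat.le_induction with
  | base => rw [windExcTo_tailMap_of_le hw hM hfix hτ le_rfl]; ring
  | succ j hj ih =>
    have hstep := ((isExcursion_iff w).1 hw).2.1 j (by omega)
    rw [(isExcursion_tailMap hw hM hfix).windExcTo_succ (by rw [length_tailMap]; omega),
      hw.windExcTo_succ hj', ih (by omega), getD_tailMap_of_ge hfix hj,
      getD_tailMap_of_ge hfix (by omega), hε hstep]
    ring

/-! ### Reflection at the first exit time -/

lemma tailMap_axisReflection {w : List (ℤ × ℤ)} (hw : IsExcursion w)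
    (h1 : w.getD 1 0 = (1, 1)) {τ : ℕ} (hτ : 1 ≤ τ) (hτ' : τ ≤ w.length - 2) {k : ℤ}
    (hk : windExcTo w τ = π / 4 * k) :
    IsExcursion (tailMap (axisReflection k) τ w) ∧
    (tailMap (axisReflection k) τ w).getD 1 0 = (1, 1) ∧
    (∀ i ≤ τ, windExcTo (tailMap (axisReflection k) τ w) i = windExcTo w i) ∧
    windExc (tailMap (axisReflection k) τ w) = π / 2 * k - windExc w := by
  have hfix := hw.axisReflection_getD h1 hτ hτ' hk
  have hM : ∀ {p q}, IsDiagStep p q → IsDiagStep (axisReflection k p) (axisReflection k q) :=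
    fun h => isDiagStep_axisReflection k h
  refine ⟨isExcursion_tailMap hw hM hfix, ?_, fun i hi => windExcTo_tailMap_of_le hw hM hfix hτ' hi, ?_⟩
  · rw [getD_tailMap_of_le _ _ hτ, h1]
  · rw [windExc_eq, windExc_eq, length_tailMap, windExcTo_tailMap_of_ge hw hM (ε := -1)
      (fun h => by rw [arg_axisReflection k h, neg_one_mul]) hfix hτ' hτ', hk]
    ring

/-- The first time at which the winding angle sequence leaves `I`. -/
def exitTime (I : Set ℝ) (w : List (ℤ × ℤ)) : ℕ := sInf {i | windExcTo w i ∉ I}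

open Classical in
/-- Reflect the part of an excursion after the first time its winding angle sequence leaves the
interval `(π/4) (jm, jp)`. -/
def reflectAtExit (jm jp : ℤ) (w : List (ℤ × ℤ)) : List (ℤ × ℤ) :=
  if ∀ i, windExcTo w i ∈ Set.Ioo (π / 4 * jm) (π / 4 * jp) then w
  else tailMap (axisReflection
    (if windExcTo w (exitTime (Set.Ioo (π / 4 * jm) (π / 4 * jp)) w) = π / 4 * jp then jp else jm))
    (exitTime (Set.Ioo (π / 4 * jm) (π / 4 * jp)) w) w

lemma exitTime_spec {I : Set ℝ} {w : List (ℤ × ℤ)} (h : ¬ ∀ i, windExcTo w i ∈ I) :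
    windExcTo w (exitTime I w) ∉ I ∧ ∀ i < exitTime I w, windExcTo w i ∈ I := by
  refine ⟨Nat.sInf_mem (s := {i | windExcTo w i ∉ I}) (not_forall.1 h), fun i hi => ?_⟩
  exact not_not.1 (Nat.notMem_of_lt_sInf hi)

lemma exitTime_le {I : Set ℝ} {w : List (ℤ × ℤ)} (h : ¬ ∀ i, windExcTo w i ∈ I) :
    exitTime I w ≤ w.length - 2 := by
  by_contra! hlt
  have h1 := (exitTime_spec h).1
  rw [← windExcTo_min, min_eq_right hlt.le] at h1
  exact h1 ((exitTime_spec h).2 _ hlt)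

lemma two_le_exitTime {I : Set ℝ} (h0 : 0 ∈ I) {w : List (ℤ × ℤ)}
    (h : ¬ ∀ i, windExcTo w i ∈ I) : 2 ≤ exitTime I w := by
  have h1 := (exitTime_spec h).1
  by_contra! hlt
  have : exitTime I w = 0 ∨ exitTime I w = 1 := by omega
  rcases this with h' | h' <;> rw [h'] at h1
  · exact h1 (by rwa [windExcTo_zero])
  · exact h1 (by rwa [windExcTo_one])

lemma exitTime_congr {I : Set ℝ} {w w' : List (ℤ × ℤ)} (h : ¬ ∀ i, windExcTo w i ∈ I)
    (hww' : ∀ i ≤ exitTime I w, windExcTo w' i = windExcTo w i) :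
    exitTime I w' = exitTime I w := by
  have hmem : windExcTo w' (exitTime I w) ∉ I := by
    rw [hww' _ le_rfl]
    exact (exitTime_spec h).1
  have h' : ¬ ∀ i, windExcTo w' i ∈ I := fun H => hmem (H _)
  refine le_antisymm (Nat.sInf_le hmem) ?_
  by_contra! hlt
  have := (exitTime_spec h').1
  rw [hww' _ hlt.le] at this
  exact this ((exitTime_spec h).2 _ hlt)

lemma zero_mem_Ioo_quarter {jm jp : ℤ} (hjm : jm < 0) (hjp : 0 < jp) :
    (0 : ℝ) ∈ Set.Ioo (π / 4 * jm) (π / 4 * jp) :=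
  ⟨mul_neg_of_pos_of_neg (by positivity) (by exact_mod_cast hjm),
    mul_pos (by positivity) (by exact_mod_cast hjp)⟩

lemma IsExcursion.windExcTo_exitTime {jm jp : ℤ} (hjm : jm < 0) (hjp : 0 < jp)
    {w : List (ℤ × ℤ)} (hw : IsExcursion w) (h1 : w.getD 1 0 = (1, 1))
    (h : ¬ ∀ i, windExcTo w i ∈ Set.Ioo (π / 4 * jm) (π / 4 * jp)) :
    windExcTo w (exitTime (Set.Ioo (π / 4 * jm) (π / 4 * jp)) w) = π / 4 * jm ∨
      windExcTo w (exitTime (Set.Ioo (π / 4 * jm) (π / 4 * jp)) w) = π / 4 * jp := by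
  have h0 := zero_mem_Ioo_quarter hjm hjp
  have hle := exitTime_le h
  have h2 := two_le_exitTime h0 h
  obtain ⟨hout, hin⟩ := exitTime_spec h
  set τ := exitTime (Set.Ioo (π / 4 * jm) (π / 4 * jp)) w
  obtain ⟨σ, hσ⟩ : ∃ σ, τ = σ + 1 := ⟨τ - 1, by omega⟩
  rw [hσ] at hout hle h2 ⊢
  obtain ⟨hl, hr⟩ := hin σ (by omega)
  have hnm := hw.windExcTo_no_jump h1 (i := σ) (by omega) hle jm
  have hnp := hw.windExcTo_no_jump h1 (i := σ) (by omega) hle jp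
  have hm := nonneg_of_mul_nonneg_right hnm (sub_pos.2 hl)
  have hp := nonpos_of_mul_nonneg_right hnp (sub_neg.2 hr)
  by_contra! hne
  exact hout ⟨lt_of_le_of_ne (by linarith) hne.1.symm, lt_of_le_of_ne (by linarith) hne.2⟩

lemma reflectAtExit_of_forall {jm jp : ℤ} {w : List (ℤ × ℤ)}
    (h : ∀ i, windExcTo w i ∈ Set.Ioo (π / 4 * jm) (π / 4 * jp)) : reflectAtExit jm jp w = w :=
  if_pos h

lemma reflectAtExit_of_not_forall {jm jp : ℤ} {w : List (ℤ × ℤ)}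
    (h : ¬ ∀ i, windExcTo w i ∈ Set.Ioo (π / 4 * jm) (π / 4 * jp)) :
    reflectAtExit jm jp w = tailMap (axisReflection
      (if windExcTo w (exitTime (Set.Ioo (π / 4 * jm) (π / 4 * jp)) w) = π / 4 * jp
        then jp else jm)) (exitTime (Set.Ioo (π / 4 * jm) (π / 4 * jp)) w) w :=
  if_neg h

lemma length_reflectAtExit (jm jp : ℤ) (w : List (ℤ × ℤ)) :
    (reflectAtExit jm jp w).length = w.length := by
  unfold reflectAtExit
  split_ifs <;> simp only [length_tailMap]

lemma IsExcursion.reflectAtExit_spec {jm jp : ℤ} (hjm : jm < 0) (hjp : 0 < jp)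
    {w : List (ℤ × ℤ)} (hw : IsExcursion w) (h1 : w.getD 1 0 = (1, 1))
    (h : ¬ ∀ i, windExcTo w i ∈ Set.Ioo (π / 4 * jm) (π / 4 * jp)) :
    IsExcursion (reflectAtExit jm jp w) ∧ (reflectAtExit jm jp w).getD 1 0 = (1, 1) ∧
    (¬ ∀ i, windExcTo (reflectAtExit jm jp w) i ∈ Set.Ioo (π / 4 * jm) (π / 4 * jp)) ∧
    (∃ j : ℤ, (j = jm ∨ j = jp) ∧ windExc (reflectAtExit jm jp w) = π / 2 * j - windExc w) ∧
    reflectAtExit jm jp (reflectAtExit jm jp w) = w := by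
  have hor := hw.windExcTo_exitTime hjm hjp h1 h
  have h2 := two_le_exitTime (zero_mem_Ioo_quarter hjm hjp) h
  have hle := exitTime_le h
  have hout := (exitTime_spec h).1
  have hcongr := fun w' => exitTime_congr (w' := w') h
  have hdef := reflectAtExit_of_not_forall h
  have hdef' := reflectAtExit_of_not_forall (jm := jm) (jp := jp) (w := reflectAtExit jm jp w)
  set τ := exitTime (Set.Ioo (π / 4 * jm) (π / 4 * jp)) w
  obtain ⟨j, hj, hjor, hjτ⟩ : ∃ j : ℤ, (if windExcTo w τ = π / 4 * jp then jp else jm) = j ∧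
      (j = jm ∨ j = jp) ∧ windExcTo w τ = π / 4 * j := by
    refine ⟨_, rfl, ?_, ?_⟩
    · split_ifs <;> simp
    · split_ifs with h'
      · exact h'
      · exact hor.resolve_right h'
  rw [hj] at hdef
  obtain ⟨hw', h1', hτ', hwind⟩ := tailMap_axisReflection hw h1 (by omega) hle hjτ
  rw [← hdef] at hw' h1' hτ' hwind
  have hbad : ¬ ∀ i, windExcTo (reflectAtExit jm jp w) i ∈
      Set.Ioo (π / 4 * jm : ℝ) (π / 4 * jp) :=
    fun H => hout (hτ' τ le_rfl ▸ H τ)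
  refine ⟨hw', h1', hbad, ⟨j, hjor, hwind⟩, ?_⟩
  rw [hdef' hbad, hcongr _ hτ', hτ' τ le_rfl, hj, hdef]
  exact tailMap_symm_tailMap (axisReflection j) τ w

/-! ### Summability -/

/-- The diagonal step encoded by a pair of signs. -/
def signStep (d : Bool × Bool) : ℤ × ℤ := (if d.1 then 1 else -1, if d.2 then 1 else -1)

/-- The walk from `p` with the given sequence of diagonal steps. -/
def walkFrom : ℤ × ℤ → List (Bool × Bool) → List (ℤ × ℤ)
  | p, [] => [p]
  | p, d :: l => p :: walkFrom (p + signStep d) l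

lemma exists_walkFrom (w : List (ℤ × ℤ)) (p : ℤ × ℤ) (h : (p :: w).IsChain IsDiagStep) :
    ∃ l, walkFrom p l = p :: w ∧ l.length = w.length := by
  induction w generalizing p with
  | nil => exact ⟨[], rfl, rfl⟩
  | cons q w ih =>
    rw [List.isChain_cons_cons] at h
    obtain ⟨l, hl, hlen⟩ := ih q h.2
    have hd : ∃ d, p + signStep d = q := by
      obtain ⟨hx, hy⟩ := (isDiagStep_iff p q).1 h.1
      refine ⟨(decide (q.1 = p.1 + 1), decide (q.2 = p.2 + 1)), ?_⟩
      ext <;> simp only [signStep, Prod.fst_add, Prod.snd_add, decide_eq_true_eq] <;>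
        split_ifs <;> omega
    obtain ⟨d, rfl⟩ := hd
    exact ⟨d :: l, by rw [walkFrom, hl], by simp [hlen]⟩

lemma summable_pow_length {A : Type*} [Fintype A] {t : ℝ} (h0 : 0 ≤ t)
    (ht : Fintype.card A * t < 1) : Summable fun l : List A => t ^ l.length := by
  rw [← List.equivSigmaTuple.symm.summable_iff]
  have hlen : ((fun l : List A => t ^ l.length) ∘ List.equivSigmaTuple.symm) =
      fun x => t ^ x.1 := by
    funext x
    simp [List.equivSigmaTuple]
  rw [hlen, summable_sigma_of_nonneg fun x => pow_nonneg h0 _]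
  refine ⟨fun n => (hasSum_fintype _).summable, ?_⟩
  have : (fun n : ℕ => ∑' _ : Fin n → A, t ^ n) = fun n => (Fintype.card A * t) ^ n := by
    funext n
    rw [tsum_fintype]
    simp [mul_pow]
  rw [this]
  exact summable_geometric_of_lt_one (by positivity) ht

lemma summable_excursion {t : ℝ} (ht : t ∈ Set.Ioo (0 : ℝ) (1 / 4)) :
    Summable fun w : {w : List (ℤ × ℤ) // IsExcursion w} => t ^ (w.val.length - 1) := by
  have hex : ∀ w : {w : List (ℤ × ℤ) // IsExcursion w}, ∃ l, walkFrom 0 l = w.val ∧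
      l.length = w.val.length - 1 := by
    rintro ⟨w, hlen, hchain, hhead, -⟩
    cases w with
    | nil => simp at hlen
    | cons p w =>
      obtain rfl : p = (0, 0) := by simpa using hhead
      exact exists_walkFrom w 0 hchain
  choose steps hsteps hlen using hex
  have hinj : Function.Injective steps := fun w w' h =>
    Subtype.ext (by rw [← hsteps w, ← hsteps w', h])
  have := (summable_pow_length (A := Bool × Bool) ht.1.le
    (by simp; linarith [ht.2])).comp_injective hinj
  refine this.congr fun w => ?_
  simp [hlen]

/-! ### Manipulation of sums -/

lemma tsum_eq_of_involutive {X : Type*} {σ : X → X} (hσ : Function.Involutive σ) {f g : X → ℝ}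
    (hf : Summable f) (hg : Summable g) (h : ∀ x, f x + f (σ x) = g x + g (σ x)) :
    ∑' x, f x = ∑' x, g x := by
  have key : ∀ u : X → ℝ, Summable u → ∑' x, (u x + u (σ x)) = 2 * ∑' x, u x := by
    intro u hu
    have hu' : Summable fun x => u (σ x) := (hσ.toPerm.summable_iff (f := u)).2 hu
    rw [hu.tsum_add hu', two_mul, hσ.toPerm.tsum_eq u |>.symm]
    rfl
  have := key f hf
  rw [tsum_congr h, key g hg] at this
  linarith

lemma tsum_subtype_and {X E : Type*} [AddCommMonoid E] [TopologicalSpace E] {P Q R : X → Prop}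
    [DecidablePred Q] (h : ∀ x, R x ↔ P x ∧ Q x) (f : X → E) :
    ∑' x : {x // R x}, f x = ∑' x : {x // P x}, if Q x then f x else 0 := by
  refine (tsum_subtype {x | R x} f).trans
    (Eq.trans ?_ (tsum_subtype {x | P x} fun x => if Q x then f x else 0).symm)
  refine tsum_congr fun x => ?_
  by_cases hP : P x <;> by_cases hQ : Q x <;> simp [Set.indicator, h, hP, hQ]

lemma sum_Ioo_cos {N : ℤ} (hN : 0 < N) (m : ℤ) :
    ∑ s ∈ Finset.Ioo (0 : ℤ) N, Real.cos (2 * π * s * m / N) =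
      (if N ∣ m then (N : ℝ) else 0) - 1 := by
  lift N to ℕ using hN.le
  have hN' : 0 < N := by exact_mod_cast hN
  have hprim := Complex.isPrimitiveRoot_exp N hN'.ne'
  set ζ := Complex.exp (2 * π * I / N) with hζ
  have hre : ∀ s : ℕ, Real.cos (2 * π * s * m / N) = ((ζ ^ m) ^ s).re := by
    intro s
    rw [hζ, ← Complex.exp_int_mul, ← Complex.exp_nat_mul, ← Complex.exp_ofReal_mul_I_re]
    congr 2
    push_cast
    ring
  have hsum : ∑ s ∈ Finset.Ioo (0 : ℤ) N, Real.cos (2 * π * s * m / (N : ℤ)) =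
      ∑ s ∈ Finset.Ioo 0 N, Real.cos (2 * π * s * m / N) := by
    refine Finset.sum_nbij' Int.toNat (fun n : ℕ => (n : ℤ)) ?_ ?_ ?_ ?_ ?_
    · intro s hs; simp only [Finset.mem_Ioo] at hs ⊢; omega
    · intro s hs; simp only [Finset.mem_Ioo] at hs ⊢; omega
    · intro s hs; simp only [Finset.mem_Ioo] at hs; omega
    · intro s hs; simp
    · intro s hs
      simp only [Finset.mem_Ioo] at hs
      lift s to ℕ using hs.1.le
      simp
  have hrange : ∑ s ∈ Finset.range N, Real.cos (2 * π * s * m / N) =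
      if (N : ℤ) ∣ m then (N : ℝ) else 0 := by
    rw [Finset.sum_congr rfl fun s _ => hre s, ← Complex.re_sum]
    split_ifs with hdvd
    · simp [(hprim.zpow_eq_one_iff_dvd m).2 hdvd]
    · have hne : ζ ^ m ≠ 1 := fun h => hdvd ((hprim.zpow_eq_one_iff_dvd m).1 h)
      rw [geom_sum_eq hne, ← zpow_natCast, ← zpow_mul, mul_comm m, zpow_mul, zpow_natCast,
        hprim.pow_eq_one, one_zpow]
      simp
  rw [hsum, Int.cast_natCast, ← hrange, Finset.range_eq_Ico, ← Finset.Ioo_insert_left hN',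
    Finset.sum_insert (by simp)]
  simp

/-! ### The generating functions as sums over excursions starting with `(1, 1)` -/

/-- Excursions with first step `(1, 1)`. -/
abbrev CornerExcursion : Type :=
  {w : List (ℤ × ℤ) // IsExcursion w ∧ w.getD 1 0 = (1, 1)}

lemma summable_cornerExcursion {t : ℝ} (ht : t ∈ Set.Ioo (0 : ℝ) (1 / 4)) :
    Summable fun w : CornerExcursion => t ^ (w.val.length - 1) :=
  (summable_excursion ht).comp_injective
    (i := fun w : CornerExcursion => (⟨w.1, w.2.1⟩ : {w : List (ℤ × ℤ) // IsExcursion w}))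
    fun _ _ h => Subtype.ext (Subtype.mk.inj h)

lemma summable_cornerExcursion_mul {t : ℝ} (ht : t ∈ Set.Ioo (0 : ℝ) (1 / 4))
    {c : CornerExcursion → ℝ} {C : ℝ} (hc : ∀ w, |c w| ≤ C) :
    Summable fun w : CornerExcursion => t ^ (w.val.length - 1) * c w := by
  refine Summable.of_norm_bounded ((summable_cornerExcursion ht).mul_right C) fun w => ?_
  rw [norm_mul, Real.norm_eq_abs, Real.norm_eq_abs, abs_of_nonneg (pow_nonneg ht.1.le _)]
  exact mul_le_mul_of_nonneg_left (hc w) (pow_nonneg ht.1.le _)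

/-- Rotation by a right angle, acting on excursions. -/
def rotateExcursion : Equiv.Perm {w : List (ℤ × ℤ) // IsExcursion w} where
  toFun w := ⟨tailMap quarterTurn 0 w.1, isExcursion_tailMap w.2 isDiagStep_quarterTurn
    (by rw [((isExcursion_iff _).1 w.2).2.2.1, map_zero])⟩
  invFun w := ⟨tailMap quarterTurn.symm 0 w.1, isExcursion_tailMap w.2
    isDiagStep_quarterTurn_symm (by rw [((isExcursion_iff _).1 w.2).2.2.1, map_zero])⟩
  left_inv w := Subtype.ext (tailMap_symm_tailMap quarterTurn 0 w.1)
  right_inv w := Subtype.ext (tailMap_symm_tailMap quarterTurn.symm 0 w.1)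

lemma getD_one_rotateExcursion (w : {w : List (ℤ × ℤ) // IsExcursion w}) :
    (rotateExcursion w).1.getD 1 0 = quarterTurn (w.1.getD 1 0) := by
  change (tailMap quarterTurn 0 w.1).getD 1 0 = _
  rw [getD_tailMap, if_neg (by norm_num)]

lemma windExc_rotateExcursion (w : {w : List (ℤ × ℤ) // IsExcursion w}) :
    windExc (rotateExcursion w).1 = windExc w.1 := by
  change windExc (tailMap quarterTurn 0 w.1) = _
  rw [windExc_eq, windExc_eq, length_tailMap,
    windExcTo_tailMap_of_ge w.2 isDiagStep_quarterTurn (ε := 1)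
      (fun _ => by rw [arg_quarterTurn, one_mul])
      (by rw [((isExcursion_iff _).1 w.2).2.2.1, map_zero]) (Nat.zero_le _) (Nat.zero_le _)]
  ring

/-- A rotation-invariant sum over excursions is four times its restriction to a given
first step. -/
lemma tsum_excursion_eq_four_mul {f : List (ℤ × ℤ) → ℂ}
    (hf : Summable fun w : {w : List (ℤ × ℤ) // IsExcursion w} => f w.1)
    (hrot : ∀ w, f (rotateExcursion w).1 = f w.1) :
    ∑' w : {w : List (ℤ × ℤ) // IsExcursion w}, f w.1 = 4 * ∑' w : CornerExcursion, f w.1 := by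
  set g : ℤ × ℤ → {w : List (ℤ × ℤ) // IsExcursion w} → ℂ :=
    fun d w => if w.1.getD 1 0 = d then f w.1 else 0 with hg
  have hgs : ∀ d, Summable (g d) := fun d =>
    Summable.of_norm_bounded hf.norm fun w => by
      simp only [hg]
      split_ifs <;> simp
  have hgrot : ∀ d, ∑' w, g (quarterTurn d) w = ∑' w, g d w := by
    intro d
    rw [← rotateExcursion.tsum_eq]
    refine tsum_congr fun w => ?_
    simp only [hg, getD_one_rotateExcursion, hrot, EmbeddingLike.apply_eq_iff_eq]
  have hdecomp : ∀ w, f w.1 = g (1, 1) w + g (quarterTurn (1, 1)) w +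
      g (quarterTurn (quarterTurn (1, 1))) w +
      g (quarterTurn (quarterTurn (quarterTurn (1, 1)))) w := by
    rintro ⟨w, hw⟩
    obtain ⟨hlen, hstep, h0, -⟩ := (isExcursion_iff w).1 hw
    obtain ⟨hx, hy⟩ := (isDiagStep_iff _ _).1 (hstep 0 (by omega))
    rw [h0] at hx hy
    simp only [Prod.fst_zero, Prod.snd_zero, zero_add, zero_sub] at hx hy
    rcases hx with hx | hx <;> rcases hy with hy | hy <;>
      simp only [hg, quarterTurn_apply, Prod.ext_iff, hx, hy] <;> norm_num
  have hcorner : ∑' w : CornerExcursion, f w.1 = ∑' w, g (1, 1) w :=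
    tsum_subtype_and (fun _ => Iff.rfl) f
  rw [tsum_congr hdecomp, Summable.tsum_add (((hgs _).add (hgs _)).add (hgs _)) (hgs _),
    Summable.tsum_add ((hgs _).add (hgs _)) (hgs _), Summable.tsum_add (hgs _) (hgs _),
    hgrot (quarterTurn (quarterTurn (1, 1))), hgrot (quarterTurn (1, 1)), hgrot (1, 1), hcorner]
  ring

lemma CornerExcursion.one_le_length (w : CornerExcursion) : 1 ≤ w.1.length - 2 := by
  obtain ⟨w, hw, h1⟩ := w
  by_contra! h
  have hw' := (isExcursion_iff w).1 hw
  have := hw'.2.2.2.1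
  rw [show w.length - 1 = 1 by have := hw'.1; simp only at h; omega, h1] at this
  simp at this

/-- Reflection in the diagonal through `(1, 1)`. -/
def diagonalReflection (w : CornerExcursion) : CornerExcursion :=
  ⟨tailMap (axisReflection 0) 1 w.1,
    have h := tailMap_axisReflection w.2.1 w.2.2 le_rfl w.one_le_length (k := 0)
      (by rw [windExcTo_one]; simp)
    ⟨h.1, h.2.1⟩⟩

lemma diagonalReflection_involutive : Function.Involutive diagonalReflection := fun w =>
  Subtype.ext (tailMap_symm_tailMap (axisReflection 0) 1 w.1)

lemma length_diagonalReflection (w : CornerExcursion) :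
    (diagonalReflection w).1.length = w.1.length := length_tailMap _ _ _

lemma windExc_diagonalReflection (w : CornerExcursion) :
    windExc (diagonalReflection w).1 = -windExc w.1 := by
  have h := (tailMap_axisReflection w.2.1 w.2.2 le_rfl w.one_le_length (k := 0)
    (by rw [windExcTo_one]; simp)).2.2.2
  rw [diagonalReflection, h]
  simp

lemma Fchar_eq {t : ℝ} (ht : t ∈ Set.Ioo (0 : ℝ) (1 / 4)) (b : ℝ) :
    Fchar t b = ((4 * ∑' w : CornerExcursion,
      t ^ (w.1.length - 1) * Real.cos (b * windExc w.1) : ℝ) : ℂ) := by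
  have hexp : ∀ θ : ℝ, Complex.I * b * θ = ((b * θ : ℝ) : ℂ) * I := by
    intro θ; push_cast; ring
  have hsum : Summable fun w : {w : List (ℤ × ℤ) // IsExcursion w} =>
      (t : ℂ) ^ (w.val.length - 1) * Complex.exp (Complex.I * b * windExc w.val) := by
    refine Summable.of_norm_bounded (summable_excursion ht) fun w => ?_
    rw [norm_mul, hexp, Complex.norm_exp_ofReal_mul_I, mul_one, norm_pow, Complex.norm_real,
      Real.norm_of_nonneg ht.1.le]
  rw [Fchar, tsum_excursion_eq_four_mul (f := fun w => (t : ℂ) ^ (w.length - 1) *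
    Complex.exp (Complex.I * b * windExc w)) hsum]
  swap
  · intro w
    rw [windExc_rotateExcursion, show (rotateExcursion w).1.length = w.1.length from
      length_tailMap _ _ _]
  have hterm : ∀ w : CornerExcursion, (t : ℂ) ^ (w.1.length - 1) *
      Complex.exp (Complex.I * b * windExc w.1) =
      ((t ^ (w.1.length - 1) * Real.cos (b * windExc w.1) : ℝ) : ℂ) +
      ((t ^ (w.1.length - 1) * Real.sin (b * windExc w.1) : ℝ) : ℂ) * I := by
    intro w
    rw [hexp, Complex.exp_mul_I]
    push_cast
    ring
  have hc : Summable fun w : CornerExcursion =>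
      t ^ (w.1.length - 1) * Real.cos (b * windExc w.1) :=
    summable_cornerExcursion_mul ht fun w => Real.abs_cos_le_one _
  have hs : Summable fun w : CornerExcursion =>
      t ^ (w.1.length - 1) * Real.sin (b * windExc w.1) :=
    summable_cornerExcursion_mul ht fun w => Real.abs_sin_le_one _
  have hs0 : ∑' w : CornerExcursion, t ^ (w.1.length - 1) * Real.sin (b * windExc w.1) = 0 := by
    rw [tsum_eq_of_involutive diagonalReflection_involutive hs summable_zero, tsum_zero]
    intro w
    rw [length_diagonalReflection, windExc_diagonalReflection, mul_neg b, Real.sin_neg]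
    ring
  rw [tsum_congr hterm, Summable.tsum_add (Complex.summable_ofReal.2 hc)
    ((Complex.summable_ofReal.2 hs).mul_right I), tsum_mul_right, ← Complex.ofReal_tsum,
    ← Complex.ofReal_tsum, hs0]
  push_cast
  ring

lemma cos_mul_Fchar {t : ℝ} (ht : t ∈ Set.Ioo (0 : ℝ) (1 / 4)) (b α : ℝ) :
    (Real.cos (b * α) : ℂ) * Fchar t b = ((4 * ∑' w : CornerExcursion,
      t ^ (w.1.length - 1) * Real.cos (b * (windExc w.1 - α)) : ℝ) : ℂ) := by
  rw [Fchar_eq ht, ← Complex.ofReal_mul, mul_left_comm, ← tsum_mul_left]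
  congr 2
  refine tsum_eq_of_involutive diagonalReflection_involutive
    ((summable_cornerExcursion_mul ht fun w => Real.abs_cos_le_one _).mul_left _)
    (summable_cornerExcursion_mul ht fun w => Real.abs_cos_le_one _) fun w => ?_
  rw [length_diagonalReflection, windExc_diagonalReflection]
  rw [mul_neg, mul_sub, mul_sub, mul_neg, Real.cos_neg, Real.cos_sub, Real.cos_sub, Real.cos_neg,
    Real.sin_neg]
  ring

/-- Reflection at the first exit time from `(π/4) (jm, jp)`, as a map on excursions with first
step `(1, 1)`. -/
def exitReflection {jm jp : ℤ} (hjm : jm < 0) (hjp : 0 < jp) (w : CornerExcursion) :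
    CornerExcursion :=
  ⟨reflectAtExit jm jp w.1, by
    by_cases h : ∀ i, windExcTo w.1 i ∈ Set.Ioo (π / 4 * jm : ℝ) (π / 4 * jp)
    · rw [reflectAtExit_of_forall h]; exact w.2
    · have := w.2.1.reflectAtExit_spec hjm hjp w.2.2 h
      exact ⟨this.1, this.2.1⟩⟩

lemma exitReflection_involutive {jm jp : ℤ} (hjm : jm < 0) (hjp : 0 < jp) :
    Function.Involutive (exitReflection hjm hjp) := by
  intro w
  apply Subtype.ext
  change reflectAtExit jm jp (reflectAtExit jm jp w.1) = w.1
  by_cases h : ∀ i, windExcTo w.1 i ∈ Set.Ioo (π / 4 * jm : ℝ) (π / 4 * jp)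
  · rw [reflectAtExit_of_forall h, reflectAtExit_of_forall h]
  · exact (w.2.1.reflectAtExit_spec hjm hjp w.2.2 h).2.2.2.2

open Classical in
/-- The reflection principle for excursions confined to a wedge. -/
lemma tsum_reflection {t : ℝ} (ht : t ∈ Set.Ioo (0 : ℝ) (1 / 4)) {jm jp ja : ℤ} (hjm : jm < 0)
    (hjp : 0 < jp) (hja : jm < 2 * ja ∧ 2 * ja < jp) {k : CornerExcursion → ℤ}
    (hk : ∀ w, windExc w.1 = π / 2 * k w) :
    ∑' w : CornerExcursion, t ^ (w.1.length - 1) *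
      ((if jp - jm ∣ k w - ja then (1 : ℝ) else 0) -
        (if jp - jm ∣ k w - (jp - ja) then 1 else 0)) =
    ∑' w : CornerExcursion, t ^ (w.1.length - 1) *
      (if k w = ja ∧ ∀ i, windExcTo w.1 i ∈ Set.Ioo (π / 4 * jm) (π / 4 * jp)
        then (1 : ℝ) else 0) := by
  refine tsum_eq_of_involutive (exitReflection_involutive hjm hjp)
    (summable_cornerExcursion_mul ht (C := 1) fun w => by split_ifs <;> norm_num)
    (summable_cornerExcursion_mul ht (C := 1) fun w => by split_ifs <;> norm_num) fun w => ?_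
  have hpi := Real.pi_pos
  by_cases h : ∀ i, windExcTo w.1 i ∈ Set.Ioo (π / 4 * jm) (π / 4 * jp)
  · have hfix : exitReflection hjm hjp w = w := Subtype.ext (reflectAtExit_of_forall h)
    have hend := h (w.1.length - 1)
    change windExc w.1 ∈ _ at hend
    rw [hk w] at hend
    have hl : jm < 2 * k w := by
      have : (jm : ℝ) < 2 * k w := by nlinarith [hend.1]
      exact_mod_cast this
    have hr : 2 * k w < jp := by
      have : (2 * k w : ℝ) < jp := by nlinarith [hend.2]
      exact_mod_cast this
    have h1 : jp - jm ∣ k w - ja ↔ k w = ja := by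
      refine ⟨fun hd => ?_, fun he => by simp [he]⟩
      have := Int.eq_zero_of_abs_lt_dvd hd (abs_lt.2 ⟨by omega, by omega⟩)
      omega
    have h2 : ¬ jp - jm ∣ k w - (jp - ja) := fun hd => by
      have := Int.eq_zero_of_abs_lt_dvd hd (abs_lt.2 ⟨by omega, by omega⟩)
      omega
    rw [hfix, if_neg h2]
    simp only [h1, h, implies_true, and_true, sub_zero]
  · obtain ⟨-, -, hbad, ⟨j, hj, hwind⟩, -⟩ := w.2.1.reflectAtExit_spec hjm hjp w.2.2 h
    change ¬ ∀ i, windExcTo (exitReflection hjm hjp w).1 i ∈ _ at hbad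
    change windExc (exitReflection hjm hjp w).1 = _ at hwind
    have hlen : (exitReflection hjm hjp w).1.length = w.1.length := length_reflectAtExit _ _ _
    have hkj : k (exitReflection hjm hjp w) = j - k w := by
      rw [hk, hk w, ← mul_sub] at hwind
      exact_mod_cast mul_left_cancel₀ (by positivity) hwind
    have hdvd : jp - jm ∣ jp - j := by
      rcases hj with rfl | rfl <;> simp
    have h1 : jp - jm ∣ j - k w - ja ↔ jp - jm ∣ k w - (jp - ja) := by
      rw [← dvd_neg, ← dvd_sub_right hdvd, ← dvd_neg]
      ring_nf
    have h2 : jp - jm ∣ j - k w - (jp - ja) ↔ jp - jm ∣ k w - ja := by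
      rw [← dvd_add_right hdvd, ← dvd_neg]
      ring_nf
    rw [hlen, hkj]
    simp only [h1, h2, h, hbad, and_false, if_false]
    ring

/-- Theorem 16: for `β₋,β₊ ∈ (π/4)ℤ` with `β₋ < 0 < β₊`, `I = (β₋,β₊)`,
`α ∈ I ∩ (π/2)ℤ` and `δ = 2(β₊-β₋)`,
`F^{(α,I)}(t) = (π/8δ) Σ_{σ ∈ (0,δ) ∩ (π/2)ℤ} (cos(4σα/δ) - cos(4σ(2β₊-α)/δ)) F(t,4σ/δ)`,
the sum over `σ = (π/2)s` for integers `0 < s < j₊ - j₋` being finite. -/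
theorem statement14 (t : ℝ) (ht : t ∈ Set.Ioo (0 : ℝ) (1 / 4))
    (jm jp : ℤ) (βm βp : ℝ) (hβm : βm = π / 4 * jm) (hβp : βp = π / 4 * jp)
    (hβ : βm < 0 ∧ 0 < βp)
    (ja : ℤ) (α : ℝ) (hα : α = π / 2 * ja) (hαmem : α ∈ Set.Ioo βm βp)
    (δ : ℝ) (hδ : δ = 2 * (βp - βm)) :
    (FgenI t α (Set.Ioo βm βp) : ℂ) =
      ((π / (8 * δ) : ℝ) : ℂ) * ∑ s ∈ Finset.Ioo (0 : ℤ) (jp - jm),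
        ((Real.cos (4 * (π / 2 * s) * α / δ)
            - Real.cos (4 * (π / 2 * s) * (2 * βp - α) / δ) : ℝ) : ℂ) *
          Fchar t (4 * (π / 2 * s) / δ) := by
  classical
  have hpi := Real.pi_pos
  have hjm : jm < 0 := by
    have : (jm : ℝ) < 0 := by nlinarith [hβ.1]
    exact_mod_cast this
  have hjp : 0 < jp := by
    have : (0 : ℝ) < jp := by nlinarith [hβ.2]
    exact_mod_cast this
  have hja : jm < 2 * ja ∧ 2 * ja < jp := by
    have h1 : (jm : ℝ) < 2 * ja := by nlinarith [hαmem.1]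
    have h2 : (2 * ja : ℝ) < jp := by nlinarith [hαmem.2]
    exact ⟨by exact_mod_cast h1, by exact_mod_cast h2⟩
  have hN : 0 < jp - jm := by omega
  have hδN : δ = π / 2 * (jp - jm : ℤ) := by rw [hδ, hβm, hβp]; push_cast; ring
  choose k hk using fun w : CornerExcursion => w.2.1.exists_windExc w.2.2
  have hangle : ∀ (s m : ℤ) (w : CornerExcursion),
      4 * (π / 2 * s) / δ * (windExc w.1 - π / 2 * m) =
        2 * π * s * (k w - m : ℤ) / (jp - jm : ℤ) := by
    intro s m w
    rw [hk, hδN, Int.cast_sub (k w)]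
    field_simp
    ring
  have hsummable : ∀ b γ : ℝ, Summable fun w : CornerExcursion =>
      t ^ (w.1.length - 1) * Real.cos (b * (windExc w.1 - γ)) :=
    fun b γ => summable_cornerExcursion_mul ht fun w => Real.abs_cos_le_one _
  have hγ : 2 * βp - α = π / 2 * (jp - ja : ℤ) := by rw [hβp, hα]; push_cast; ring
  have hterm : ∀ s : ℤ, ((Real.cos (4 * (π / 2 * s) * α / δ)
      - Real.cos (4 * (π / 2 * s) * (2 * βp - α) / δ) : ℝ) : ℂ) * Fchar t (4 * (π / 2 * s) / δ) =
      ((4 * ∑' w : CornerExcursion, t ^ (w.1.length - 1) *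
        (Real.cos (2 * π * s * (k w - ja : ℤ) / (jp - jm : ℤ)) -
          Real.cos (2 * π * s * (k w - (jp - ja) : ℤ) / (jp - jm : ℤ))) : ℝ) : ℂ) := by
    intro s
    rw [mul_div_right_comm (4 * (π / 2 * s : ℝ)) α δ,
      mul_div_right_comm (4 * (π / 2 * s : ℝ)) (2 * βp - α) δ, Complex.ofReal_sub, sub_mul,
      cos_mul_Fchar ht, cos_mul_Fchar ht, ← Complex.ofReal_sub, ← mul_sub, ← (hsummable _ _).tsum_sub (hsummable _ _),
      hγ, hα]
    simp only [hangle, mul_sub]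
  have hFgen : FgenI t α (Set.Ioo βm βp) = ∑' w : CornerExcursion, t ^ (w.1.length - 1) *
      (if k w = ja ∧ ∀ i, windExcTo w.1 i ∈ Set.Ioo (π / 4 * jm) (π / 4 * jp)
        then (1 : ℝ) else 0) := by
    rw [FgenI, tsum_subtype_and (P := fun w => IsExcursion w ∧ w.getD 1 0 = (1, 1))
      (Q := fun w => windExc w = α ∧ ∀ i ≤ w.length - 1, windExcTo w i ∈ Set.Ioo βm βp)
      (fun w => by simp only [and_assoc]) fun w => t ^ (w.length - 1)]
    refine tsum_congr fun w => ?_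
    have hiff : (windExc w.1 = α ∧ ∀ i ≤ w.1.length - 1, windExcTo w.1 i ∈ Set.Ioo βm βp) ↔
        (k w = ja ∧ ∀ i, windExcTo w.1 i ∈ Set.Ioo (π / 4 * jm) (π / 4 * jp)) := by
      rw [hk, hα, mul_right_inj' (by positivity), Int.cast_inj, hβm, hβp]
      refine and_congr_right fun _ => ⟨fun H i => ?_, fun H i _ => H i⟩
      rw [← windExcTo_min]
      exact H _ (by omega)
    simp only [hiff, mul_ite, mul_one, mul_zero]
  rw [Finset.sum_congr rfl fun s _ => hterm s, ← Complex.ofReal_sum, ← Complex.ofReal_mul, hFgen,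
    ← tsum_reflection ht hjm hjp hja hk, ← Finset.mul_sum, ← Summable.tsum_finsetSum]
  swap
  · exact fun s _ => summable_cornerExcursion_mul ht (C := 2) fun w =>
      calc
        _ ≤ |Real.cos _| + |Real.cos _| := abs_sub _ _
        _ ≤ 1 + 1 := by gcongr <;> exact Real.abs_cos_le_one _
        _ = 2 := one_add_one_eq_two
  congr 1
  rw [← tsum_mul_left, ← tsum_mul_left]
  refine tsum_congr fun w => ?_
  rw [← Finset.mul_sum, Finset.sum_sub_distrib, sum_Ioo_cos hN, sum_Ioo_cos hN, hδN]
  split_ifs <;> field_simp <;> ring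

end
end

section
/- (Gessel's lattice path conjecture.) For every integer n ≥ 0, the number of excursions w of length 2n+2 with first step w_1 = (1,1), winding angle θ^w = 0, and winding angle sequence satisfying θ^w_i ∈ (−π/4, π/2) for all 0 ≤ i ≤ |w|, equals 16^n·((5/6)_n·(1/2)_n)/((2)_n·(5/3)_n), where (a)_n = a(a+1)⋯(a+n−1) = Γ(a+n)/Γ(a) is the Pochhammer symbol. -/
open Complex Real Set

noncomputable section

/-- The Pochhammer symbol `(a)_n = a(a+1)⋯(a+n-1)`. -/
def poch (a : ℝ) (n : ℕ) : ℝ := ∏ i ∈ Finset.range n, (a + i)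

namespace Gessel

open PowerSeries

/-- A series `δ(x)` over `ℚ⟦t⟧` which is regular of order one in `x` has a unique root in
`tℚ⟦t⟧`, so that evaluation at this root is defined. -/
theorem exists_evalHom (δ : ℚ⟦X⟧⟦X⟧) (h0 : constantCoeff (constantCoeff δ) = 0)
    (h1 : constantCoeff (coeff 1 δ) ≠ 0) :
    ∃ ev : ℚ⟦X⟧⟦X⟧ →+* ℚ⟦X⟧, (∀ a, ev (C a) = a) ∧ ev δ = 0 ∧
      ∀ f, constantCoeff (ev f) = constantCoeff (constantCoeff f) := by
  set J : Ideal ℚ⟦X⟧ := Ideal.span {X}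
  have hJ : ∀ a : ℚ⟦X⟧, Ideal.Quotient.mk J a = 0 ↔ constantCoeff a = 0 := fun a => by
    rw [Ideal.Quotient.eq_zero_iff_mem, Ideal.mem_span_singleton, X_dvd_iff]
  have hord : (δ.map (Ideal.Quotient.mk J)).order.toNat = 1 := by
    have : (δ.map (Ideal.Quotient.mk J)).order = (1 : ℕ) := by
      rw [order_eq_nat]
      refine ⟨by simpa [hJ] using h1, fun i hi => ?_⟩
      obtain rfl : i = 0 := by omega
      simpa [hJ] using h0
    rw [this]; rfl
  have hW : IsWeierstrassDivisorAt δ J := by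
    rw [IsWeierstrassDivisorAt, hord, isUnit_iff_constantCoeff]
    exact h1.isUnit
  have hsurj : Function.Surjective ((Ideal.Quotient.mk (Ideal.span {δ})).comp C) := by
    intro z
    obtain ⟨f, rfl⟩ := Ideal.Quotient.mk_surjective z
    obtain ⟨hd, he⟩ := hW.isWeierstrassDivisionAt_div_mod f
    rw [hord] at hd
    have hr := Polynomial.eq_C_of_degree_le_zero (Polynomial.degree_lt_iff_coeff_zero _ _ |>.1 hd |>
      fun h => Polynomial.degree_le_iff_coeff_zero _ _ |>.2 fun m hm => h m (by exact_mod_cast hm))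
    refine ⟨(hW.mod f).coeff 0, ?_⟩
    rw [RingHom.comp_apply, Ideal.Quotient.eq, Ideal.mem_span_singleton]
    refine ⟨-hW.div f, ?_⟩
    rw [hr, Polynomial.coe_C] at he
    linear_combination -he
  have hinj : Function.Injective ((Ideal.Quotient.mk (Ideal.span {δ})).comp C) := by
    rw [injective_iff_map_eq_zero]
    intro a ha
    rw [RingHom.comp_apply, Ideal.Quotient.eq_zero_iff_mem, Ideal.mem_span_singleton] at ha
    obtain ⟨q, hq⟩ := ha
    have := hW.eq_zero_of_mul_eq (q := q) (r := Polynomial.C a)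
      (by rw [hord]; exact Polynomial.degree_C_le.trans_lt (by norm_num))
      (by rw [Polynomial.coe_C]; exact hq.symm)
    simpa using this.2
  let e := RingEquiv.ofBijective _ ⟨hinj, hsurj⟩
  have hC : ∀ a, e a = Ideal.Quotient.mk (Ideal.span {δ}) (C a) := fun a => rfl
  refine ⟨(e.symm : _ →+* ℚ⟦X⟧).comp (Ideal.Quotient.mk (Ideal.span {δ})), fun a => ?_, ?_,
    fun f => ?_⟩
  · simp [← hC]
  · have : Ideal.Quotient.mk (Ideal.span {δ}) δ = 0 := by simp
    simp [this]
  · set a := ((e.symm : _ →+* ℚ⟦X⟧).comp (Ideal.Quotient.mk (Ideal.span {δ}))) f with ha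
    have h : Ideal.Quotient.mk (Ideal.span {δ}) (C a) = Ideal.Quotient.mk (Ideal.span {δ}) f := by
      rw [← hC, ha]; simp
    rw [Ideal.Quotient.eq, Ideal.mem_span_singleton] at h
    obtain ⟨q, hq⟩ := h
    have := congrArg (fun z => constantCoeff (constantCoeff z)) hq
    simp only [map_sub, map_mul, h0, zero_mul, constantCoeff_C, sub_eq_zero] at this
    exact this

/-- The kernel `xy(1 - t S(x,y))` of Gessel's walks, as a series in `y` over `ℚ⟦t⟧⟦x⟧`. -/
def kernel : ℚ⟦X⟧⟦X⟧⟦X⟧ :=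
  C X * X - C (C X) * (1 + C X) * (C X * X ^ 2 + 1)

/-- The invariant lemma: a multiple of the kernel that splits as a series in `x` minus a series
in `y` vanishes. -/
theorem eq_zero_of_kernel_dvd {f g : ℚ⟦X⟧⟦X⟧} {H : ℚ⟦X⟧⟦X⟧⟦X⟧}
    (h : map C f - C g = kernel * H) : H = 0 := by
  have key : ∀ n i j, (X : ℚ⟦X⟧) ^ n ∣ coeff i (coeff j H) := by
    intro n
    induction n with
    | zero => simp
    | succ n ih =>
      have hH : ∃ H', H = C (C (X ^ n)) * H' := by
        choose u hu using fun i j => ih i j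
        refine ⟨mk fun j => mk fun i => u i j, ?_⟩
        ext1 j
        ext1 i
        rw [coeff_C_mul, coeff_C_mul, hu]
        simp
      obtain ⟨H', hH'⟩ := hH
      intro i j
      have h1 : C X * (X * H) = map C f - C g +
          C (C (X ^ (n + 1))) * ((1 + C X) * (C X * X ^ 2 + 1) * H') := by
        rw [h, kernel, pow_succ (X : ℚ⟦X⟧) n, map_mul, map_mul]
        linear_combination (C (C X) * (1 + C X) * (C X * X ^ 2 + 1)) * hH'
      have h2 := congrArg (fun z => coeff (i + 1) (coeff (j + 1) z)) h1
      simp only [coeff_C_mul, coeff_succ_X_mul, map_add, map_sub, coeff_map, coeff_C,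
        Nat.succ_ne_zero, if_false] at h2
      rw [h2]
      simp
  ext1 j
  ext1 i
  ext1 n
  have := X_pow_dvd_iff.1 (key (n + 1) i j) n (by omega)
  simpa using this

instance : CharZero ℚ⟦X⟧ := algebraRat.charZero _

theorem ne_of_constantCoeff_ne {f g : ℚ⟦X⟧} (h : constantCoeff f ≠ constantCoeff g) : f - g ≠ 0 :=
  fun e => h (by rw [sub_eq_zero.1 e])

/-- Rational parametrization of the curve defined by the critical values of the cubic. -/
theorem exists_param {g w : ℚ⟦X⟧} (hg : constantCoeff g = 1) (hw : constantCoeff w = 0)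
    (hwg : w * g ^ 3 = X ^ 2)
    (hgw : g ^ 2 + 18 * g * w - 27 * w ^ 2 = 1 + 16 * X ^ 2) :
    ∃ p : ℚ⟦X⟧, constantCoeff p = 1 ∧ 256 * X ^ 2 * p ^ 6 = (p ^ 2 - 1) * (p ^ 2 + 3) ^ 3 ∧
      4 * p ^ 3 * (g + 3 * w) = p ^ 4 + 6 * p ^ 2 - 3 := by
  set D : ℚ⟦X⟧ := 4 * g ^ 2 - 3 with hD
  have hD0 : constantCoeff D = 1 := by simp [hD, hg, map_ofNat]; norm_num
  have hD1 : D * D⁻¹ = 1 := PowerSeries.mul_inv_cancel _ (by simp [hD0])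
  obtain ⟨h, hh⟩ : ∃ h, h = (9 * g - 8 * g ^ 3 - 27 * w) * D⁻¹ := ⟨_, rfl⟩
  have hDne : D ≠ 0 := fun e => by simp [e] at hD0
  have hhD : h * D = 9 * g - 8 * g ^ 3 - 27 * w := by
    rw [hh]; linear_combination (9 * g - 8 * g ^ 3 - 27 * w) * hD1
  have hh0 : constantCoeff h = 1 := by
    have := congrArg constantCoeff hhD
    simp [hD0, hg, hw, map_ofNat] at this
    rw [this]; norm_num
  have hsq : h ^ 2 = 4 * g ^ 2 - 3 := by
    have : D ^ 2 * (h ^ 2 - (4 * g ^ 2 - 3)) = 0 := by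
      have e : (h * D) ^ 2 = D ^ 3 := by
        rw [hhD, hD]
        linear_combination (-27) * hgw + 432 * hwg
      linear_combination e - D ^ 2 * hD
    rcases mul_eq_zero.1 this with h' | h'
    · exact absurd (pow_eq_zero_iff (by norm_num) |>.1 h') hDne
    · exact sub_eq_zero.1 h'
  have h4 : 4 * (2 * g - h) * g = (2 * g - h) ^ 2 + 3 := by linear_combination -hsq
  have h2 : 2 * h * (2 * g - h) = 3 - (2 * g - h) ^ 2 := by linear_combination -hsq
  have hw27 : 27 * w = 9 * g - 8 * g ^ 3 - h ^ 3 := by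
    linear_combination hhD - h * hD + h * hsq
  set p := 2 * g - h with hp
  have hpw : 4 * p ^ 3 * w = p ^ 2 - 1 := by
    have e1 : (2 * h * p) ^ 3 = (3 - p ^ 2) ^ 3 := by rw [h2]
    have e2 : (4 * p * g) ^ 3 = (p ^ 2 + 3) ^ 3 := by rw [h4]
    have : (54 : ℚ⟦X⟧) * (4 * p ^ 3 * w - (p ^ 2 - 1)) = 0 := by
      linear_combination 8 * p ^ 3 * hw27 + 18 * p ^ 2 * h4 - e2 - e1
    exact sub_eq_zero.1 ((mul_eq_zero.1 this).resolve_left (OfNat.ofNat_ne_zero _))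
  refine ⟨p, by simp [hp, hg, hh0, map_ofNat]; norm_num, ?_, ?_⟩
  · have e2 : (4 * p * g) ^ 3 = (p ^ 2 + 3) ^ 3 := by rw [h4]
    linear_combination (-256 * p ^ 6) * hwg + (p ^ 2 - 1) * e2 + 64 * p ^ 3 * g ^ 3 * hpw
  · linear_combination p ^ 2 * h4 + 3 * hpw

/-- Elimination of `b` and `c` between three equations for double roots of cubics. -/
theorem param_of_double_roots {a b c n m v ρ : ℚ⟦X⟧} (ha : a = -1 - 2 * X * ρ)
    (hn : constantCoeff n = 1) (hm : constantCoeff m = -1) (hv : constantCoeff v = 1)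
    (e1 : X * n ^ 3 + a * n ^ 2 + (b + 2) * n + c = 0)
    (d1 : 3 * X * n ^ 2 + 2 * a * n + (b + 2) = 0)
    (e2 : X * m ^ 3 + a * m ^ 2 + (b - 2) * m + c = 0)
    (d2 : 3 * X * m ^ 2 + 2 * a * m + (b - 2) = 0)
    (e3 : v ^ 3 + 2 * a * v ^ 2 + (4 * b * X + 16 * X ^ 2 + 1) * v + 8 * c * X ^ 2 = 0)
    (d3 : 3 * v ^ 2 + 4 * a * v + (4 * b * X + 16 * X ^ 2 + 1) = 0) :
    ∃ p : ℚ⟦X⟧, constantCoeff p = 1 ∧ 256 * X ^ 2 * p ^ 6 = (p ^ 2 - 1) * (p ^ 2 + 3) ^ 3 ∧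
      4 * p ^ 3 * (1 + 2 * X * ρ) = p ^ 4 + 6 * p ^ 2 - 3 := by
  obtain ⟨N, hN⟩ : ∃ N, N = 2 * X * n := ⟨_, rfl⟩
  obtain ⟨M, hM⟩ : ∃ M, M = 2 * X * m := ⟨_, rfl⟩
  have hN0 : constantCoeff N = 0 := by simp [hN]
  have hM0 : constantCoeff M = 0 := by simp [hM]
  have cN : N ^ 3 + a * N ^ 2 = 4 * c * X ^ 2 := by
    rw [hN]; linear_combination 4 * X ^ 2 * (n * d1 - e1)
  have cM : M ^ 3 + a * M ^ 2 = 4 * c * X ^ 2 := by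
    rw [hM]; linear_combination 4 * X ^ 2 * (m * d2 - e2)
  have cv : v ^ 3 + a * v ^ 2 = 4 * c * X ^ 2 := by
    have : (2 : ℚ⟦X⟧) * (v ^ 3 + a * v ^ 2 - 4 * c * X ^ 2) = 0 := by
      linear_combination v * d3 - e3
    exact sub_eq_zero.1 ((mul_eq_zero.1 this).resolve_left (OfNat.ofNat_ne_zero _))
  have qN : N ^ 2 + N * v + v ^ 2 + a * (N + v) = 0 := by
    have : (v - N) * (N ^ 2 + N * v + v ^ 2 + a * (N + v)) = 0 := by linear_combination cv - cN
    exact (mul_eq_zero.1 this).resolve_left (ne_of_constantCoeff_ne (by simp [hN0, hv]))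
  have qM : M ^ 2 + M * v + v ^ 2 + a * (M + v) = 0 := by
    have : (v - M) * (M ^ 2 + M * v + v ^ 2 + a * (M + v)) = 0 := by linear_combination cv - cM
    exact (mul_eq_zero.1 this).resolve_left (ne_of_constantCoeff_ne (by simp [hM0, hv]))
  have hNM : N - M ≠ 0 := by
    rw [hN, hM, ← mul_sub]
    refine mul_ne_zero (mul_ne_zero two_ne_zero X_ne_zero) (ne_of_constantCoeff_ne ?_)
    rw [hn, hm]; norm_num
  have hsum : N + M + v = -a := by
    have : (N - M) * (N + M + v + a) = 0 := by linear_combination qN - qM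
    linear_combination (mul_eq_zero.1 this).resolve_left hNM
  have hprod : N * M + (N + M) * v = 0 := by
    linear_combination (N + v) * hsum - qN
  have hdiff : (N - M) * ((N + M) + 4 * v) = 16 * X := by
    have : 3 * (N ^ 2 - M ^ 2) + 4 * a * (N - M) = -16 * X := by
      rw [hN, hM]; linear_combination 4 * X * (d1 - d2)
    linear_combination -this + 4 * (N - M) * hsum
  have hmid : 2 * (3 * v ^ 2 + 4 * a * v + 16 * X ^ 2 + 1) =
      3 * (N ^ 2 + M ^ 2) + 4 * a * (N + M) := by
    rw [hN, hM]; linear_combination 2 * d3 - 4 * X * (d1 + d2)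
  obtain ⟨w, hw⟩ : ∃ w : ℚ⟦X⟧, N + M = 4 * w := ⟨C (1 / 4) * (N + M), by
    rw [← map_ofNat (C (R := ℚ)) 4, ← mul_assoc, ← map_mul]; norm_num⟩
  have hw0 : constantCoeff w = 0 := by
    have := congrArg constantCoeff hw
    simpa [hN0, hM0, map_ofNat] using this.symm
  obtain ⟨p, hp, hp1, hp2⟩ := exists_param (g := v + w) (w := w) (by simp [hv, hw0]) hw0
    (by
      have : (256 : ℚ⟦X⟧) * (w * (v + w) ^ 3 - X ^ 2) = 0 := by
        have e : (N - M) ^ 2 = 16 * w ^ 2 + 16 * w * v := by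
          linear_combination (N + M + 4 * w) * hw + 4 * v * hw - 4 * hprod
        have hd2 := congrArg (fun z => z ^ 2) hdiff
        simp only [mul_pow, hw, e] at hd2
        linear_combination hd2
      exact sub_eq_zero.1 ((mul_eq_zero.1 this).resolve_left (OfNat.ofNat_ne_zero _)))
    (by
      have ea : a = -(4 * w + v) := by linear_combination hsum - hw
      have eNM : N * M = -(4 * w * v) := by linear_combination hprod - v * hw
      have es : N ^ 2 + M ^ 2 = 16 * w ^ 2 + 8 * w * v := by
        linear_combination (N + M + 4 * w) * hw - 2 * eNM
      rw [es, ea, hw] at hmid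
      have : (2 : ℚ⟦X⟧) * ((v + w) ^ 2 + 18 * (v + w) * w - 27 * w ^ 2 - (1 + 16 * X ^ 2)) = 0 := by
        linear_combination -hmid
      exact sub_eq_zero.1 ((mul_eq_zero.1 this).resolve_left (OfNat.ofNat_ne_zero _)))
  refine ⟨p, hp, hp1, ?_⟩
  have : 1 + 2 * X * ρ = v + w + 3 * w := by linear_combination ha - hsum + hw
  rw [this]; exact hp2

/-- The algebraic series `G` satisfies a hypergeometric recurrence. -/
theorem coeff_rec_of_param {p G : ℚ⟦X⟧} (hp : constantCoeff p = 1)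
    (hpt : 256 * X ^ 2 * p ^ 6 = (p ^ 2 - 1) * (p ^ 2 + 3) ^ 3)
    (hG : 4 * p ^ 3 * G = p ^ 4 + 6 * p ^ 2 - 3) (n : ℕ) :
    (n + 2 : ℚ) * (3 * n + 4) * coeff (n + 2) G = 16 * (3 * n - 1) * (n - 1) * coeff n G := by
  have hp0 : p ≠ 0 := fun h => by simp [h] at hp
  have hκ : p ^ 2 - 3 ≠ 0 := fun h => by
    have := congrArg constantCoeff h
    simp [hp, map_ofNat] at this
    norm_num at this
  have hκ' : p ^ 2 + 3 ≠ 0 := fun h => by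
    have := congrArg constantCoeff h
    simp [hp, map_ofNat] at this
    norm_num at this
  obtain ⟨θ, hθ⟩ : ∃ θ : Derivation ℚ ℚ⟦X⟧ ℚ⟦X⟧, θ = (X : ℚ⟦X⟧) • d⁄dX ℚ := ⟨_, rfl⟩
  have hcoeff : ∀ (f : ℚ⟦X⟧) n, coeff n (θ f) = n * coeff n f := by
    rintro f (_ | n)
    · simp [hθ]
    · simp [hθ, coeff_succ_X_mul, coeff_derivative, mul_comm]
  have hX : θ X = X := by simp [hθ]
  have hnum : ∀ (k : ℕ) [k.AtLeastTwo], θ (OfNat.ofNat k : ℚ⟦X⟧) = 0 := fun k _ => by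
    rw [← map_ofNat (algebraMap ℚ ℚ⟦X⟧) k]; exact θ.map_algebraMap _
  have h1 : (p ^ 2 - 3) ^ 2 * θ p = p * (p ^ 2 - 1) * (p ^ 2 + 3) := by
    have e := congrArg θ hpt
    simp only [Derivation.leibniz, Derivation.leibniz_pow, map_sub, map_add, hX, hnum,
      Derivation.map_one_eq_zero, smul_eq_mul, nsmul_eq_mul] at e
    push_cast at e
    have : 2 * (p ^ 2 + 3) ^ 2 * ((p ^ 2 - 3) ^ 2 * θ p - p * (p ^ 2 - 1) * (p ^ 2 + 3)) = 0 := by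
      linear_combination (2 * p + 6 * θ p) * hpt - p * e
    exact sub_eq_zero.1 ((mul_eq_zero.1 this).resolve_left
      (mul_ne_zero two_ne_zero (pow_ne_zero _ hκ')))
  have h2 : 4 * p ^ 3 * θ G = (p ^ 2 - 1) * (p ^ 2 + 3) := by
    have e := congrArg θ hG
    simp only [Derivation.leibniz, Derivation.leibniz_pow, map_sub, map_add, hnum,
      smul_eq_mul, nsmul_eq_mul] at e
    push_cast at e
    have : p * (4 * p ^ 3 * θ G - (p ^ 2 - 1) * (p ^ 2 + 3)) = 0 := by
      linear_combination p * e - 3 * θ p * hG + h1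
    exact sub_eq_zero.1 ((mul_eq_zero.1 this).resolve_left hp0)
  have h3 : 4 * p ^ 3 * (p ^ 2 - 3) ^ 2 * θ (θ G) =
      (p ^ 4 - 2 * p ^ 2 + 9) * (p ^ 2 - 1) * (p ^ 2 + 3) := by
    have e := congrArg θ h2
    simp only [Derivation.leibniz, Derivation.leibniz_pow, map_sub, map_add, hnum,
      Derivation.map_one_eq_zero, smul_eq_mul, nsmul_eq_mul] at e
    push_cast at e
    have : p * (4 * p ^ 3 * (p ^ 2 - 3) ^ 2 * θ (θ G) -
      (p ^ 4 - 2 * p ^ 2 + 9) * (p ^ 2 - 1) * (p ^ 2 + 3)) = 0 := by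
      linear_combination (p ^ 2 - 3) ^ 2 * p * e - 3 * θ p * (p ^ 2 - 3) ^ 2 * h2 +
        (p ^ 4 - 2 * p ^ 2 + 9) * h1
    exact sub_eq_zero.1 ((mul_eq_zero.1 this).resolve_left hp0)
  have h4 : 3 * θ (θ G) - 2 * θ G = 16 * X ^ 2 * (3 * θ (θ G) - 4 * θ G + G) := by
    have : 64 * p ^ 9 * (p ^ 2 - 3) ^ 2 * (3 * θ (θ G) - 2 * θ G -
        16 * X ^ 2 * (3 * θ (θ G) - 4 * θ G + G)) = 0 := by
      linear_combination (48 * p ^ 6 - 3 * ((p ^ 2 - 1) * (p ^ 2 + 3) ^ 3)) * h3 +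
        (4 * ((p ^ 2 - 1) * (p ^ 2 + 3) ^ 3) - 32 * p ^ 6) * (p ^ 2 - 3) ^ 2 * h2 -
        (p ^ 2 - 1) * (p ^ 2 + 3) ^ 3 * (p ^ 2 - 3) ^ 2 * hG -
        4 * p ^ 3 * (p ^ 2 - 3) ^ 2 * (3 * θ (θ G) - 4 * θ G + G) * hpt
    exact sub_eq_zero.1 ((mul_eq_zero.1 this).resolve_left (mul_ne_zero (mul_ne_zero
      (OfNat.ofNat_ne_zero _) (pow_ne_zero _ hp0)) (pow_ne_zero _ hκ)))
  have h5 := congrArg (coeff (n + 2)) h4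
  simp only [← map_ofNat (C (R := ℚ)), mul_assoc, map_sub, map_add, coeff_C_mul,
    coeff_X_pow_mul, hcoeff] at h5
  push_cast at h5
  linear_combination h5

theorem constantCoeff_map_apply {R S : Type*} [CommSemiring R] [CommSemiring S] (f : R →+* S)
    (φ : R⟦X⟧) : constantCoeff (φ.map f) = f (constantCoeff φ) := by
  rw [← coeff_zero_eq_constantCoeff_apply, coeff_map, coeff_zero_eq_constantCoeff_apply]

/-- Number of `n`-step Gessel walks in the quadrant from the origin to `(i, j)`. -/
def numWalks : ℕ → ℕ → ℕ → ℕ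
  | 0, 0, 0 => 1
  | 0, _, _ => 0
  | n + 1, 0, 0 => numWalks n 1 1 + numWalks n 0 1
  | n + 1, i + 1, 0 => numWalks n (i + 2) 1 + numWalks n (i + 1) 1
  | n + 1, 0, j + 1 => numWalks n 1 (j + 2) + numWalks n 0 (j + 2) + numWalks n 0 j
  | n + 1, i + 1, j + 1 => numWalks n i j + numWalks n (i + 2) (j + 2) +
      numWalks n (i + 1) (j + 2) + numWalks n (i + 1) j

/-- The generating series of Gessel walks, as a series in `y` over `ℚ⟦t⟧⟦x⟧`. -/
def genSeries : ℚ⟦X⟧⟦X⟧⟦X⟧ := mk fun j => mk fun i => mk fun n => (numWalks n i j : ℚ)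

theorem kernel_mul_genSeries :
    kernel * genSeries = C X * X - C (C X * (1 + X) * constantCoeff genSeries) -
      map C (C X * genSeries.map constantCoeff) +
      C (C (X * constantCoeff (constantCoeff genSeries))) := by
  have key : C X * (X * genSeries) + C (C X * constantCoeff genSeries) +
      C (X * (C X * constantCoeff genSeries)) + map C (C X * genSeries.map constantCoeff) =
      C X * X + C (C X) * genSeries + C X * (C (C X) * genSeries) +
      C X * (X * (X * (C (C X) * genSeries))) +
      C X * (C X * (X * (X * (C (C X) * genSeries)))) +
      C (C (X * constantCoeff (constantCoeff genSeries))) := by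
    ext j i n
    rcases j with _ | _ | j <;> rcases i with _ | _ | i <;> rcases n with _ | n <;>
      simp [genSeries, numWalks, coeff_C_mul, coeff_succ_X_mul, coeff_succ_C, coeff_X,
        coeff_zero_X_mul, constantCoeff_map_apply]
    all_goals try ring
  rw [kernel]
  simp only [map_mul, map_add, map_one] at key ⊢
  linear_combination key

theorem exists_eq_X_mul_add_C {R : Type*} [Semiring R] (f : R⟦X⟧) :
    ∃ g, f = X * g + C (constantCoeff f) :=
  ⟨_, eq_X_mul_shift_add_const f⟩

/-- The kernel divides `xy m(x) - t(1+x) l(y)` for series `m`, `l` built from the boundary values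
of the generating series. -/
theorem exists_decoupling : ∃ (m V : ℚ⟦X⟧⟦X⟧) (N : ℚ⟦X⟧⟦X⟧⟦X⟧),
    constantCoeff (constantCoeff m) = 1 ∧
    constantCoeff V = X * constantCoeff (constantCoeff genSeries) ∧
    C X * X * C m - C (C X) * (1 + C X) * (1 + X * map C V) = kernel * N := by
  set ρ := X * constantCoeff (constantCoeff genSeries) with hρ
  obtain ⟨R, hR⟩ : ∃ R : ℚ⟦X⟧⟦X⟧, C X * (1 + X) * constantCoeff genSeries = X * R + C ρ := by
    have := exists_eq_X_mul_add_C (C X * (1 + X) * constantCoeff genSeries)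
    simp only [map_mul, map_add, map_one, constantCoeff_C, constantCoeff_X, add_zero,
      mul_one] at this
    simpa only [hρ, map_mul] using this
  have h := kernel_mul_genSeries
  rw [hR, ← hρ] at h
  refine ⟨1 - C X * (1 + X) * R, C X * genSeries.map constantCoeff,
    C (C X) * (1 + C X) * X * genSeries + 1, ?_, ?_, ?_⟩
  · simp
  · simp [constantCoeff_map_apply, hρ]
  · simp only [map_add, map_sub, map_mul, map_one, map_C] at h ⊢
    have hk := kernel.eq_1
    linear_combination (-(C (C X) * (1 + C X) * X)) * h - hk

theorem C_X_ne_zero {R : Type*} [Semiring R] [Nontrivial R] : (C X : R⟦X⟧⟦X⟧) ≠ 0 :=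
  (map_ne_zero_iff C C_injective).2 X_ne_zero

theorem dvd_of_mul_eq_kernel_mul {F H : ℚ⟦X⟧⟦X⟧⟦X⟧} (h : C X * X ^ 3 * F = kernel * H) :
    ∃ H', F = kernel * H' := by
  have hk : ¬ X ∣ kernel := by
    rw [X_dvd_iff]
    intro h
    have := congrArg (coeff 0) h
    simp [kernel] at this
  obtain ⟨H₁, rfl⟩ : X ^ 3 ∣ H :=
    X_prime.pow_dvd_of_dvd_mul_left 3 hk ⟨C X * F, by rw [← h]; ring⟩
  have h₁ : C X * F = kernel * H₁ :=
    mul_left_cancel₀ (pow_ne_zero 3 (X_ne_zero (R := ℚ⟦X⟧⟦X⟧))) (by linear_combination h)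
  have h₂ : H₁.map constantCoeff = 0 := by
    have e := congrArg (map constantCoeff) h₁
    simpa [kernel, C_X_ne_zero] using e
  have h₃ : ∀ j, X ∣ coeff j H₁ := fun j => by
    rw [X_dvd_iff]
    simpa using congrArg (coeff j) h₂
  choose u hu using h₃
  have h₄ : H₁ = C X * mk u := by
    ext1 j
    rw [coeff_C_mul, coeff_mk, hu]
  refine ⟨mk u, mul_left_cancel₀ C_X_ne_zero (by rw [h₁, h₄]; ring)⟩

/-- The boundary series satisfy cubic equations with a common set of unknown coefficients. -/
theorem exists_cubic_relations : ∃ (a b c : ℚ⟦X⟧) (m l : ℚ⟦X⟧⟦X⟧),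
    a = -1 - 2 * X * (X * constantCoeff (constantCoeff genSeries)) ∧
    constantCoeff (constantCoeff m) = 1 ∧ constantCoeff l = 1 ∧
    C X * l ^ 3 + C a * X * l ^ 2 + C b * X ^ 2 * l + C c * X ^ 3 +
      (X * (1 + X ^ 2) - C X * (1 - X ^ 2) ^ 2) * l = 0 ∧
    X ^ 3 * m ^ 3 + C a * (1 + X) * X ^ 2 * m ^ 2 + C b * C X * X * m * (1 + X) ^ 2 +
      C c * C X ^ 2 * (1 + X) ^ 3 + m * (C X ^ 2 * (1 + X) ^ 4 + X ^ 2) = 0 := by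
  obtain ⟨m, V, N, hm, hV, hN⟩ := exists_decoupling
  set ρ := X * constantCoeff (constantCoeff genSeries)
  obtain ⟨a, ha⟩ : ∃ a, a = -1 - 2 * X * ρ := ⟨_, rfl⟩
  obtain ⟨V₁, hV₁⟩ : ∃ V₁, V = X * V₁ + C ρ := ⟨_, hV ▸ eq_X_mul_shift_add_const V⟩
  obtain ⟨b, K₁, hK₁⟩ : ∃ b K₁, 2 * C X * V₁ + C X * V ^ 2 + C a * V + X + 2 * C X - C X * X ^ 2 =
      X * K₁ - C b := by
    obtain ⟨K₁, h⟩ := exists_eq_X_mul_add_C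
      (2 * C X * V₁ + C X * V ^ 2 + C a * V + X + 2 * C X - C X * X ^ 2)
    exact ⟨_, K₁, h.trans (by rw [sub_eq_add_neg (X * K₁), ← map_neg, neg_neg])⟩
  obtain ⟨l, hl⟩ : ∃ l, l = 1 + X * V := ⟨_, rfl⟩
  obtain ⟨c, e, he0, he⟩ : ∃ c e, constantCoeff e = 0 ∧ l * K₁ + C c = e :=
    ⟨-constantCoeff K₁, _, by simp [hl], rfl⟩
  have hEy : C X * l ^ 3 + C a * X * l ^ 2 + C b * X ^ 2 * l + C c * X ^ 3 +
      (X * (1 + X ^ 2) - C X * (1 - X ^ 2) ^ 2) * l = X ^ 3 * e := by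
    have ha' : C a = -1 - 2 * C X * C ρ := by simp [ha, map_ofNat]
    have : C X * l ^ 2 + C a * X * l + (X * (1 + X ^ 2) - C X * (1 - X ^ 2) ^ 2) =
        X ^ 2 * (X * K₁ - C b) := by
      rw [← hK₁]
      linear_combination (2 * C X * X) * hV₁ + X * ha' + (C X * (l + 1 + X * V) + C a * X) * hl
    linear_combination l * this + X ^ 3 * he
  obtain ⟨e', he'⟩ : ∃ e', X ^ 3 * m ^ 3 + C a * (1 + X) * X ^ 2 * m ^ 2 +
      C b * C X * X * m * (1 + X) ^ 2 + C c * C X ^ 2 * (1 + X) ^ 3 +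
      m * (C X ^ 2 * (1 + X) ^ 4 + X ^ 2) = e' := ⟨_, rfl⟩
  have hdvd : ∃ H, C (C X) ^ 2 * (1 + C X) ^ 3 * map C e - C e' = kernel * H := by
    have hy := congrArg (map C) hEy
    have hx := congrArg C he'
    have hl' := congrArg (map C) hl
    simp only [map_add, map_sub, map_mul, map_pow, map_one, map_C, map_X] at hx hy hl'
    rw [← hl'] at hN
    obtain ⟨L, hL⟩ : ∃ L, L = C (C X) * (1 + C X) * map C l := ⟨_, rfl⟩
    obtain ⟨P, hP⟩ : ∃ P : ℚ⟦X⟧⟦X⟧⟦X⟧, P = C X * X * C m := ⟨_, rfl⟩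
    rw [← hL, ← hP] at hN
    obtain ⟨S, hS⟩ : ∃ S, S = C X * (L ^ 2 + L * P + P ^ 2) +
        C (C a) * C X * X * (1 + C X) * (L + P) +
        C (C b) * C X * X ^ 2 * C (C X) * (1 + C X) ^ 2 +
        X ^ 2 * (C (C X) ^ 2 * (1 + C X) ^ 4 + C X ^ 2) := ⟨_, rfl⟩
    refine dvd_of_mul_eq_kernel_mul
      (H := -N * S - L * (C X * X - C (C X) * (1 + C X) * (C X + X ^ 2))) ?_
    have hk := kernel.eq_1
    have hJ : C (C X) * C X * (1 + C X) ^ 2 * (X * (1 + X ^ 2) - C (C X) * (1 - X ^ 2) ^ 2) -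
        X ^ 2 * (C (C X) ^ 2 * (1 + C X) ^ 4 + C X ^ 2) =
        -kernel * (C X * X - C (C X) * (1 + C X) * (C X + X ^ 2)) := by
      rw [hk]; ring
    have hSL : S * (L - P) = C X * (L ^ 3 - P ^ 3) +
        C (C a) * C X * X * (1 + C X) * (L ^ 2 - P ^ 2) +
        (C (C b) * C X * X ^ 2 * C (C X) * (1 + C X) ^ 2 +
        X ^ 2 * (C (C X) ^ 2 * (1 + C X) ^ 4 + C X ^ 2)) * (L - P) := by
      rw [hS]; ring
    have hH : C X * X ^ 3 * (C (C X) ^ 2 * (1 + C X) ^ 3 * map C e - C e') = S * (L - P) +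
        L * (C (C X) * C X * (1 + C X) ^ 2 * (X * (1 + X ^ 2) - C (C X) * (1 - X ^ 2) ^ 2) -
        X ^ 2 * (C (C X) ^ 2 * (1 + C X) ^ 4 + C X ^ 2)) := by
      rw [hSL, hL, hP]
      linear_combination C X * X ^ 3 * hx - C X * C (C X) ^ 2 * (1 + C X) ^ 3 * hy
    linear_combination hH + L * hJ - S * hN
  obtain ⟨H, hH⟩ := hdvd
  obtain ⟨u, hu⟩ : ∃ u : ℚ⟦X⟧⟦X⟧, u * (1 + X) ^ 3 = 1 :=
    IsUnit.exists_left_inv ((isUnit_iff_constantCoeff.2 (by simp)).pow 3)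
  have hu' := congrArg C hu
  simp only [map_mul, map_pow, map_add, map_one] at hu'
  have h₁ : map C (C X ^ 2 * e) - C (u * e') = kernel * (C u * H) := by
    simp only [map_mul, map_pow, map_C]
    linear_combination C u * hH - C (C X) ^ 2 * map C e * hu'
  rw [eq_zero_of_kernel_dvd h₁, mul_zero, sub_eq_zero] at h₁
  have h₂ : u * e' = 0 := by
    have := congrArg constantCoeff h₁
    simpa [constantCoeff_map_apply, he0] using this.symm
  have he'0 : e' = 0 := by linear_combination (1 + X) ^ 3 * h₂ - e' * hu
  have he0 : e = 0 := by
    rw [h₂, map_zero] at h₁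
    have : C X ^ 2 * e = 0 := by
      ext1 j
      have := congrArg (coeff j) h₁
      rw [coeff_map, map_zero, map_eq_zero_iff C C_injective] at this
      rw [this, map_zero]
    exact (mul_eq_zero.1 this).resolve_left (pow_ne_zero 2 C_X_ne_zero)
  exact ⟨a, b, c, m, l, ha, hm, by simp [hl], by rw [hEy, he0, mul_zero], by rw [he', he'0]⟩

/-- If a cubic polynomial in a series `z` is divisible by `δ ^ 2`, then the value of `z` at the
root of `δ` is a double root of the cubic. -/
theorem double_root_of_sq_dvd {δ z w : ℚ⟦X⟧⟦X⟧} {ev : ℚ⟦X⟧⟦X⟧ →+* ℚ⟦X⟧}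
    (hC : ∀ a, ev (C a) = a) (hδ : ev δ = 0)
    (hev : ∀ f, constantCoeff (ev f) = constantCoeff (constantCoeff f))
    {a₃ a₂ a₁ a₀ : ℚ⟦X⟧} (hz : constantCoeff (coeff 1 z) ≠ 0)
    (h : C a₃ * z ^ 3 + C a₂ * z ^ 2 + C a₁ * z + C a₀ = δ ^ 2 * w) :
    a₃ * ev z ^ 3 + a₂ * ev z ^ 2 + a₁ * ev z + a₀ = 0 ∧
      3 * a₃ * ev z ^ 2 + 2 * a₂ * ev z + a₁ = 0 := by
  constructor
  · simpa [hC, hδ] using congrArg ev h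
  · have e := congrArg ev (congrArg (d⁄dX ℚ⟦X⟧) h)
    have hz' : ev (d⁄dX ℚ⟦X⟧ z) ≠ 0 := fun h0 => hz <| by
      have := hev (d⁄dX ℚ⟦X⟧ z)
      rw [h0, ← coeff_zero_eq_constantCoeff_apply (d⁄dX ℚ⟦X⟧ z), coeff_derivative] at this
      simpa using this.symm
    have hd : ∀ r : ℚ⟦X⟧, d⁄dX ℚ⟦X⟧ (C r) = 0 := fun r => derivative_C
    simp only [map_add, Derivation.leibniz, Derivation.leibniz_pow, hd, smul_eq_mul, nsmul_eq_mul,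
      map_mul, map_pow, hC, hδ, map_natCast, map_zero] at e
    refine (mul_eq_zero.1 ?_).resolve_left hz'
    push_cast at e
    linear_combination e

theorem exists_double_root_x {ε a b c : ℚ⟦X⟧} {m : ℚ⟦X⟧⟦X⟧} (hε : ε ^ 2 = 1)
    (hm : constantCoeff (constantCoeff m) = 1)
    (h : X ^ 3 * m ^ 3 + C a * (1 + X) * X ^ 2 * m ^ 2 + C b * C X * X * m * (1 + X) ^ 2 +
      C c * C X ^ 2 * (1 + X) ^ 3 + m * (C X ^ 2 * (1 + X) ^ 4 + X ^ 2) = 0) :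
    ∃ n, constantCoeff n = constantCoeff ε ∧
      X * n ^ 3 + a * n ^ 2 + (b + 2 * ε) * n + c = 0 ∧
      3 * X * n ^ 2 + 2 * a * n + (b + 2 * ε) = 0 := by
  have hε0 : constantCoeff ε ≠ 0 := fun h0 => by
    simpa [h0] using congrArg constantCoeff hε
  obtain ⟨δ, hδd⟩ : ∃ δ : ℚ⟦X⟧⟦X⟧, δ = C X * (1 + X) ^ 2 - C ε * X := ⟨_, rfl⟩
  obtain ⟨ev, hC, hδ, hev⟩ := exists_evalHom δ (by simp [hδd])
    (by
      have : δ = C X + X * (C X * (2 + X) - C ε) := by rw [hδd]; ring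
      rw [this]
      simpa [coeff_succ_X_mul, coeff_C] using hε0)
  obtain ⟨u, hu⟩ : ∃ u : ℚ⟦X⟧⟦X⟧, u * (1 + X) = 1 :=
    IsUnit.exists_left_inv (isUnit_iff_constantCoeff.2 (by simp))
  have hu0 : constantCoeff u = 1 := by simpa using congrArg constantCoeff hu
  have hε' : (C ε : ℚ⟦X⟧⟦X⟧) ^ 2 = 1 := by rw [← map_pow, hε, map_one]
  obtain ⟨hr, hd⟩ := double_root_of_sq_dvd (z := X * (m * u)) (w := -(m * u ^ 3)) (a₃ := 1)
    (a₂ := a) (a₁ := X * (b + 2 * ε)) (a₀ := c * X ^ 2) hC hδ hev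
    (by
      rw [show (1 : ℕ) = 0 + 1 from rfl, coeff_succ_X_mul]
      simp [hm, hu0])
    (by
      have hu2 : u ^ 2 * (1 + X) ^ 2 = 1 := by rw [← mul_pow, hu, one_pow]
      have hu3 : u ^ 3 * (1 + X) ^ 3 = 1 := by rw [← mul_pow, hu, one_pow]
      simp only [map_one, map_mul, map_pow, map_add, map_ofNat]
      rw [hδd]
      linear_combination u ^ 3 * h - C a * X ^ 2 * m ^ 2 * u ^ 2 * hu -
        (C b + 2 * C ε) * C X * X * m * u * hu2 - C c * C X ^ 2 * hu3 + m * u ^ 3 * X ^ 2 * hε')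
  have hδ' : X * (1 + ev X) ^ 2 = ε * ev X := by
    have := hδ
    rw [hδd] at this
    simp only [map_sub, map_mul, map_pow, map_add, map_one, hC] at this
    linear_combination this
  have huev : ev u * (1 + ev X) = 1 := by
    have := congrArg ev hu
    simpa only [map_mul, map_add, map_one] using this
  have hz : ev (X * (m * u)) = X * (ε * (1 + ev X) * ev m) := by
    simp only [map_mul]
    linear_combination -ε * ev m * ev u * hδ' + ε * X * (1 + ev X) * ev m * huev -
      ev X * ev m * ev u * hε
  rw [hz] at hr hd
  refine ⟨ε * (1 + ev X) * ev m, by simp [hev, hm], ?_, ?_⟩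
  · refine (mul_eq_zero.1 ?_).resolve_left (pow_ne_zero 2 (X_ne_zero (R := ℚ)))
    linear_combination hr
  · refine (mul_eq_zero.1 ?_).resolve_left (X_ne_zero (R := ℚ))
    linear_combination hd

theorem exists_double_root_y {a b c : ℚ⟦X⟧} {l : ℚ⟦X⟧⟦X⟧} (hl : constantCoeff l = 1)
    (h : C X * l ^ 3 + C a * X * l ^ 2 + C b * X ^ 2 * l + C c * X ^ 3 +
      (X * (1 + X ^ 2) - C X * (1 - X ^ 2) ^ 2) * l = 0) :
    ∃ v, constantCoeff v = 1 ∧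
      v ^ 3 + 2 * a * v ^ 2 + (4 * b * X + 16 * X ^ 2 + 1) * v + 8 * c * X ^ 2 = 0 ∧
      3 * v ^ 2 + 4 * a * v + (4 * b * X + 16 * X ^ 2 + 1) = 0 := by
  obtain ⟨δ, hδd⟩ : ∃ δ : ℚ⟦X⟧⟦X⟧, δ = 2 * C X * (1 + X ^ 2) - X := ⟨_, rfl⟩
  obtain ⟨ev, hC, hδ, hev⟩ := exists_evalHom δ (by simp [hδd])
    (by
      have : δ = C (2 * X) + X * (2 * C X * X - 1) := by
        rw [hδd, map_mul, map_ofNat]; ring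
      rw [this]
      simp [coeff_succ_X_mul])
  obtain ⟨u, hu⟩ : ∃ u : ℚ⟦X⟧⟦X⟧, u * l = 1 :=
    IsUnit.exists_left_inv (isUnit_iff_constantCoeff.2 (by simp [hl]))
  have hu0 : constantCoeff u = 1 := by simpa [hl] using congrArg constantCoeff hu
  obtain ⟨hr, hd⟩ := double_root_of_sq_dvd (z := X * u) (w := u ^ 2) (a₃ := 4 * X * c)
    (a₂ := 4 * X * b + 16 * X ^ 2 + 1) (a₁ := 4 * X * a) (a₀ := 4 * X ^ 2) hC hδ hev
    (by
      rw [show (1 : ℕ) = 0 + 1 from rfl, coeff_succ_X_mul]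
      simp [hu0])
    (by
      have hu2 : u ^ 2 * l ^ 2 = 1 := by rw [← mul_pow, hu, one_pow]
      have hu3 : u ^ 3 * l ^ 3 = 1 := by rw [← mul_pow, hu, one_pow]
      simp only [map_one, map_mul, map_pow, map_add, map_ofNat]
      rw [hδd]
      linear_combination 4 * C X * u ^ 3 * h - 4 * C X ^ 2 * hu3 - 4 * C X * C a * X * u * hu2 -
        (4 * C X * C b * X ^ 2 * u ^ 2 +
          4 * C X * u ^ 2 * (X * (1 + X ^ 2) - C X * (1 - X ^ 2) ^ 2)) * hu)
  have hδ' : 2 * X * (1 + ev X ^ 2) = ev X := by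
    have := hδ
    rw [hδd] at this
    simp only [map_sub, map_mul, map_pow, map_add, map_one, hC, map_ofNat] at this
    linear_combination this
  have hz : ev (X * u) = 2 * X * ((1 + ev X ^ 2) * ev u) := by
    rw [map_mul]
    linear_combination -ev u * hδ'
  obtain ⟨ν, hν⟩ : ∃ ν, ν = (1 + ev X ^ 2) * ev u := ⟨_, rfl⟩
  have hν0 : constantCoeff ν = 1 := by simp [hν, hev, hu0]
  obtain ⟨v, hv⟩ : ∃ v, v * ν = 1 :=
    IsUnit.exists_left_inv (isUnit_iff_constantCoeff.2 (by simp [hν0]))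
  rw [hz, ← hν] at hr hd
  have hr' : 1 + 2 * a * ν + (4 * b * X + 16 * X ^ 2 + 1) * ν ^ 2 + 8 * c * X ^ 2 * ν ^ 3 = 0 := by
    refine (mul_eq_zero.1 ?_).resolve_left
      (mul_ne_zero (OfNat.ofNat_ne_zero 4) (pow_ne_zero 2 (X_ne_zero (R := ℚ))))
    linear_combination hr
  have hd' : a + (4 * b * X + 16 * X ^ 2 + 1) * ν + 12 * c * X ^ 2 * ν ^ 2 = 0 := by
    refine (mul_eq_zero.1 ?_).resolve_left
      (mul_ne_zero (OfNat.ofNat_ne_zero 4) (X_ne_zero (R := ℚ)))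
    linear_combination hd
  refine ⟨v, by simpa [hν0] using congrArg constantCoeff hv, ?_, ?_⟩
  · have hv2 : v ^ 2 * ν ^ 2 = 1 := by rw [← mul_pow, hv, one_pow]
    have hv3 : v ^ 3 * ν ^ 3 = 1 := by rw [← mul_pow, hv, one_pow]
    linear_combination v ^ 3 * hr' - 2 * a * v ^ 2 * hv -
      (4 * b * X + 16 * X ^ 2 + 1) * v * hv2 - 8 * c * X ^ 2 * hv3
  · have hv2 : v ^ 2 * ν ^ 2 = 1 := by rw [← mul_pow, hv, one_pow]
    linear_combination 3 * v ^ 2 * hr' - 2 * v ^ 2 * ν * hd' - 4 * a * v * hv -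
      (4 * b * X + 16 * X ^ 2 + 1) * hv2

theorem coeff_genSeries_rec (n : ℕ) :
    (n + 4 : ℚ) * (3 * n + 10) * coeff (n + 2) (constantCoeff (constantCoeff genSeries)) =
      16 * (3 * n + 5) * (n + 1) * coeff n (constantCoeff (constantCoeff genSeries)) := by
  obtain ⟨a, b, c, m, l, ha, hm, hl, hy, hx⟩ := exists_cubic_relations
  obtain ⟨n₁, hn₁, e₁, d₁⟩ := exists_double_root_x (ε := 1) (by simp) hm hx
  obtain ⟨n₂, hn₂, e₂, d₂⟩ := exists_double_root_x (ε := -1) (by simp) hm hx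
  obtain ⟨v, hv, e₃, d₃⟩ := exists_double_root_y hl hy
  obtain ⟨p, hp, hpt, hG⟩ := param_of_double_roots ha (by simpa using hn₁) (by simpa using hn₂) hv
    (by linear_combination e₁) (by linear_combination d₁) (by linear_combination e₂)
    (by linear_combination d₂) e₃ d₃
  have hcoeff : ∀ k, coeff (k + 2)
      (1 + 2 * X * (X * constantCoeff (constantCoeff genSeries)) : ℚ⟦X⟧) =
      2 * coeff k (constantCoeff (constantCoeff genSeries)) := fun k => by
    rw [map_add, coeff_one, if_neg (by omega), zero_add, ← map_ofNat (C (R := ℚ)), mul_assoc,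
      coeff_C_mul, coeff_succ_X_mul, coeff_succ_X_mul]
  have := coeff_rec_of_param hp hpt hG (n + 2)
  rw [hcoeff, hcoeff] at this
  push_cast at this
  linear_combination this / 2

theorem numWalks_rec (n : ℕ) :
    (n + 2) * (3 * n + 5) * numWalks (2 * (n + 1)) 0 0 =
      4 * (6 * n + 5) * (2 * n + 1) * numWalks (2 * n) 0 0 := by
  have h := coeff_genSeries_rec (2 * n)
  simp only [genSeries, constantCoeff_mk, coeff_mk] at h
  rw [show 2 * n + 2 = 2 * (n + 1) by ring] at h
  push_cast at h
  have : ((n + 2) * (3 * n + 5) * numWalks (2 * (n + 1)) 0 0 : ℚ) =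
      4 * (6 * n + 5) * (2 * n + 1) * numWalks (2 * n) 0 0 := by linear_combination h / 4
  exact_mod_cast this

theorem numWalks_eq (n : ℕ) : (numWalks (2 * n) 0 0 : ℝ) =
    16 ^ n * (poch (5 / 6) n * poch (1 / 2) n) / (poch 2 n * poch (5 / 3) n) := by
  have hpos : ∀ a : ℝ, 0 < a → ∀ n, 0 < poch a n := fun a ha n =>
    Finset.prod_pos fun i _ => by positivity
  have hsucc : ∀ (a : ℝ) n, poch a (n + 1) = poch a n * (a + n) := fun a n =>
    Finset.prod_range_succ _ _
  induction n with
  | zero => simp [poch, numWalks]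
  | succ n ih =>
    have h₁ := hpos 2 (by norm_num) n
    have h₂ := hpos (5 / 3) (by norm_num) n
    have hrec : ((n + 2) * (3 * n + 5) * numWalks (2 * (n + 1)) 0 0 : ℝ) =
      4 * (6 * n + 5) * (2 * n + 1) * numWalks (2 * n) 0 0 := by exact_mod_cast numWalks_rec n
    rw [ih] at hrec
    simp only [hsucc]
    rw [eq_div_iff (by positivity)]
    have : (n + 2 : ℝ) * (3 * n + 5) ≠ 0 := by positivity
    apply mul_left_cancel₀ this
    rw [← mul_assoc, hrec]
    field_simp
    ring

/-- The open cone of points whose argument lies in `(0, 3π/4)`. -/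
def InCone (p : ℤ × ℤ) : Prop := 0 < p.2 ∧ 0 < p.1 + p.2

/-- The diagonal steps. -/
def diagSteps : Finset (ℤ × ℤ) := {(1, 1), (1, -1), (-1, -1), (-1, 1)}

open Classical in
/-- The diagonal walks in the cone with `n` steps leading from `p` to `(1, 1)`. -/
def coneWalks : ℕ → ℤ × ℤ → Finset (List (ℤ × ℤ))
  | 0, p => if p = (1, 1) then {[(1, 1)]} else ∅
  | n + 1, p => if InCone p then
      diagSteps.biUnion fun s => (coneWalks n (p + s)).image (p :: ·) else ∅

theorem mem_coneWalks (n : ℕ) (p : ℤ × ℤ) (l : List (ℤ × ℤ)) :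
    l ∈ coneWalks n p ↔ l.length = n + 1 ∧ l.head? = some p ∧ l.getLast? = some (1, 1) ∧
      l.IsChain IsDiagStep ∧ ∀ x ∈ l, InCone x := by
  have hstep : ∀ a b, IsDiagStep a b ↔ b - a ∈ diagSteps := fun a b => by
    simp [IsDiagStep, diagSteps]
  induction n generalizing p l with
  | zero =>
    rcases l with _ | ⟨a, _ | ⟨b, l⟩⟩
    · rw [coneWalks]; split_ifs <;> simp
    · by_cases h : p = (1, 1)
      · subst h
        simp [coneWalks]
        rintro rfl
        simp [InCone]
      · simp [coneWalks, h]
        rintro rfl rfl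
        exact absurd rfl h
    · by_cases h : p = (1, 1) <;> simp [coneWalks, h]
  | succ n ih =>
    rcases l with _ | ⟨a, _ | ⟨b, l⟩⟩
    · rw [coneWalks]; split_ifs <;> simp
    · by_cases h : InCone p <;> simp [coneWalks, h, ih]
    · by_cases h : InCone p
      · simp only [coneWalks, h, if_true, Finset.mem_biUnion, Finset.mem_image, ih]
        constructor
        · rintro ⟨s, hs, l', ⟨h1, h2, h3, h4, h5⟩, h6⟩
          obtain ⟨rfl, rfl⟩ := List.cons.inj h6
          simp only [List.head?_cons, Option.some.injEq] at h2
          subst h2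
          refine ⟨by simpa using h1, rfl, by simpa using h3, ?_, ?_⟩
          · rw [List.isChain_cons_cons]
            exact ⟨(hstep _ _).2 (by simpa using hs), h4⟩
          · simpa [h] using h5
        · rintro ⟨h1, h2, h3, h4, h5⟩
          simp only [List.head?_cons, Option.some.injEq] at h2
          subst h2
          rw [List.isChain_cons_cons] at h4
          refine ⟨b - a, (hstep _ _).1 h4.1, b :: l, ⟨by simpa using h1, by simp, by simpa using h3,
            h4.2, fun x hx => h5 x (List.mem_cons_of_mem _ hx)⟩, rfl⟩
      · simp only [coneWalks, h, if_false, Finset.notMem_empty, false_iff]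
        rintro ⟨-, h2, -, -, h5⟩
        simp only [List.head?_cons, Option.some.injEq] at h2
        exact h (h2 ▸ h5 a (by simp))

theorem coneWalks_eq_empty {n : ℕ} {p : ℤ × ℤ} (h : ¬ InCone p) : coneWalks n p = ∅ := by
  ext l
  rw [mem_coneWalks]
  simp only [Finset.notMem_empty, iff_false]
  rintro ⟨-, h2, -, -, h5⟩
  exact h (h5 p (List.mem_of_mem_head? h2))

theorem card_coneWalks_succ {n : ℕ} {p : ℤ × ℤ} (h : InCone p) :
    (coneWalks (n + 1) p).card = (coneWalks n (p + (1, 1))).card +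
      (coneWalks n (p + (1, -1))).card + (coneWalks n (p + (-1, -1))).card +
      (coneWalks n (p + (-1, 1))).card := by
  rw [coneWalks, if_pos h, Finset.card_biUnion]
  · simp only [Finset.card_image_of_injective _ List.cons_injective]
    rw [diagSteps, Finset.sum_insert (by decide), Finset.sum_insert (by decide),
      Finset.sum_insert (by decide), Finset.sum_singleton]
    ring
  · intro s _ s' _ hss
    rw [Function.onFun, Finset.disjoint_left]
    intro l hl hl'
    simp only [Finset.mem_image, mem_coneWalks] at hl hl'
    obtain ⟨u, ⟨-, hu, -⟩, rfl⟩ := hl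
    obtain ⟨v, ⟨-, hv, -⟩, huv⟩ := hl'
    obtain rfl := List.cons_injective huv
    rw [hu] at hv
    exact hss (by simpa using hv)

theorem card_coneWalks (n i j : ℕ) :
    (coneWalks n (2 * (i : ℤ) + 1 - j, (j : ℤ) + 1)).card = numWalks n i j := by
  induction n generalizing i j with
  | zero =>
    rcases j with _ | j <;> rcases i with _ | i <;> simp [coneWalks, numWalks] <;> omega
  | succ n ih =>
    rw [card_coneWalks_succ (by simp only [InCone]; omega)]
    have e₁ : ((2 * (i : ℤ) + 1 - j, (j : ℤ) + 1) : ℤ × ℤ) + (1, 1) =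
        (2 * ((i + 1 : ℕ) : ℤ) + 1 - ((j + 1 : ℕ) : ℤ), ((j + 1 : ℕ) : ℤ) + 1) := by
          ext <;> push_cast <;> simp
          ring
    have e₄ : ((2 * (i : ℤ) + 1 - j, (j : ℤ) + 1) : ℤ × ℤ) + (-1, 1) =
        (2 * (i : ℤ) + 1 - ((j + 1 : ℕ) : ℤ), ((j + 1 : ℕ) : ℤ) + 1) := by
          ext <;> push_cast <;> simp
          ring
    rw [e₁, e₄, ih, ih]
    rcases j with _ | j
    · rw [coneWalks_eq_empty (p := _ + (1, -1)) (by simp [InCone]),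
        coneWalks_eq_empty (p := _ + (-1, -1)) (by simp [InCone])]
      rcases i with _ | i <;> simp [numWalks]
    · have e₂ : ((2 * (i : ℤ) + 1 - ((j + 1 : ℕ) : ℤ), ((j + 1 : ℕ) : ℤ) + 1) : ℤ × ℤ) + (1, -1) =
          (2 * (i : ℤ) + 1 - j, (j : ℤ) + 1) := by
        ext <;> push_cast <;> simp
        ring
      rw [e₂, ih]
      rcases i with _ | i
      · rw [coneWalks_eq_empty (p := _ + (-1, -1)) (by
          simp only [InCone, Prod.fst_add, Prod.snd_add]
          push_cast
          omega)]
        simp [numWalks]; ring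
      · have e₃ : ((2 * ((i + 1 : ℕ) : ℤ) + 1 - ((j + 1 : ℕ) : ℤ), ((j + 1 : ℕ) : ℤ) + 1) : ℤ × ℤ) +
            (-1, -1) = (2 * (i : ℤ) + 1 - j, (j : ℤ) + 1) := by
          ext <;> push_cast <;> simp
          ring
        rw [e₃, ih, numWalks]; ring

theorem ptC_ne_zero {p : ℤ × ℤ} (hp : p ≠ (0, 0)) : ptC p ≠ 0 := fun h => by
  rw [Complex.ext_iff] at h
  simp only [ptC, add_re, intCast_re, mul_re, intCast_im, I_re, I_im, zero_re, add_im, mul_im,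
    zero_im] at h
  exact hp (Prod.ext (by simpa using h.1) (by simpa using h.2))

theorem InCone.ne_zero {p : ℤ × ℤ} (hp : InCone p) : p ≠ (0, 0) := by
  rintro rfl
  simp [InCone] at hp

theorem norm_mul_cos_arg_ptC (p : ℤ × ℤ) : ‖ptC p‖ * Real.cos (ptC p).arg = p.1 := by
  rw [norm_mul_cos_arg]
  simp [ptC]

theorem norm_mul_sin_arg_ptC (p : ℤ × ℤ) : ‖ptC p‖ * Real.sin (ptC p).arg = p.2 := by
  rw [norm_mul_sin_arg]
  simp [ptC]

theorem norm_mul_sin_sub_arg_ptC (p : ℤ × ℤ) :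
    ‖ptC p‖ * Real.sin (3 * π / 4 - (ptC p).arg) = √2 / 2 * (p.1 + p.2 : ℤ) := by
  have hs : Real.sin (3 * π / 4) = √2 / 2 := by
    rw [show 3 * π / 4 = π - π / 4 by ring, Real.sin_pi_sub, Real.sin_pi_div_four]
  have hc : Real.cos (3 * π / 4) = -(√2 / 2) := by
    rw [show 3 * π / 4 = π - π / 4 by ring, Real.cos_pi_sub, Real.cos_pi_div_four]
  rw [Real.sin_sub, hs, hc]
  push_cast
  linear_combination √2 / 2 * (norm_mul_cos_arg_ptC p + norm_mul_sin_arg_ptC p)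

theorem inCone_iff_arg {p : ℤ × ℤ} (hp : p ≠ (0, 0)) :
    InCone p ↔ (ptC p).arg ∈ Ioo 0 (3 * π / 4) := by
  have hn : 0 < ‖ptC p‖ := norm_pos_iff.2 (ptC_ne_zero hp)
  have h₁ := norm_mul_sin_arg_ptC p
  have h₂ := norm_mul_sin_sub_arg_ptC p
  have h2 : 0 < √2 / 2 := by positivity
  have hle := arg_le_pi (ptC p)
  have hlt := neg_pi_lt_arg (ptC p)
  constructor
  · rintro ⟨hy, hxy⟩
    have hs : 0 < Real.sin (ptC p).arg :=
      pos_of_mul_pos_right (h₁ ▸ by exact_mod_cast hy) hn.le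
    have hpos : 0 < (ptC p).arg := by
      by_contra! h
      exact absurd hs (not_lt.2 (Real.sin_nonpos_of_nonpos_of_neg_pi_le h hlt.le))
    have hs' : 0 < Real.sin (3 * π / 4 - (ptC p).arg) :=
      pos_of_mul_pos_right (h₂ ▸ mul_pos h2 (by exact_mod_cast hxy)) hn.le
    refine ⟨hpos, ?_⟩
    by_contra! h
    exact absurd hs' (not_lt.2 (Real.sin_nonpos_of_nonpos_of_neg_pi_le (by linarith)
      (by linarith [pi_pos])))
  · rintro ⟨hpos, hlt'⟩
    have hs := Real.sin_pos_of_pos_of_lt_pi hpos (by linarith [pi_pos])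
    have hs' := Real.sin_pos_of_pos_of_lt_pi (x := 3 * π / 4 - (ptC p).arg) (by linarith)
      (by linarith [pi_pos])
    have h₃ := h₁ ▸ mul_pos hn hs
    have h₄ := pos_of_mul_pos_right (h₂ ▸ mul_pos hn hs') h2.le
    exact ⟨by exact_mod_cast h₃, by exact_mod_cast h₄⟩

/-- Among the neighbours of the origin in the cone, `(1, 1)` is the one of argument `π/4`. -/
theorem eq_one_one_iff {p : ℤ × ℤ} (hp : InCone p) (hs : IsDiagStep p (0, 0)) :
    p = (1, 1) ↔ (ptC p).arg = π / 4 := by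
  have h₁ := norm_mul_cos_arg_ptC p
  have h₂ := norm_mul_sin_arg_ptC p
  constructor
  · rintro rfl
    have : Real.cos (ptC (1, 1)).arg = Real.sin (ptC (1, 1)).arg := by
      refine mul_left_cancel₀ (norm_ne_zero_iff.2 (ptC_ne_zero hp.ne_zero)) ?_
      rw [h₁, h₂]
    have hz : Real.sin ((ptC (1, 1)).arg - π / 4) = 0 := by
      rw [Real.sin_sub, Real.sin_pi_div_four, Real.cos_pi_div_four, this]
      ring
    have hm := (inCone_iff_arg hp.ne_zero).1 hp
    rw [Real.sin_eq_zero_iff_of_lt_of_lt (by linarith [hm.1, pi_pos])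
      (by linarith [hm.2, pi_pos])] at hz
    linarith
  · intro h
    rw [h, Real.cos_pi_div_four] at h₁
    rw [h, Real.sin_pi_div_four, h₁] at h₂
    have h₃ : p.1 = p.2 := by exact_mod_cast h₂
    have h₄ := hp.1
    obtain ⟨x, y⟩ := p
    simp only [IsDiagStep, Prod.mk_sub_mk, Prod.mk.injEq] at hs h₃ h₄ ⊢
    omega

theorem eq_of_coe_angle_eq {x y : ℝ} (h : (x : Real.Angle) = y) (hx : x ∈ Ioc (-π) π)
    (hy : y ∈ Ioc (-π) π) : x = y := by
  rw [← Real.Angle.toReal_coe_eq_self_iff_mem_Ioc.2 hx, h,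
    Real.Angle.toReal_coe_eq_self_iff_mem_Ioc.2 hy]

/-- The winding angle of a walk along `f` that starts at `f 1`. -/
def angleSum (f : ℕ → ℤ × ℤ) (k : ℕ) : ℝ :=
  ∑ j ∈ Finset.Icc 2 k, (ptC (f j) / ptC (f (j - 1))).arg

theorem angleSum_succ (f : ℕ → ℤ × ℤ) {k : ℕ} (hk : 1 ≤ k) :
    angleSum f (k + 1) = angleSum f k + (ptC (f (k + 1)) / ptC (f k)).arg := by
  rw [angleSum, Finset.sum_Icc_succ_top (by omega)]
  rfl

theorem angleSum_eq {f : ℕ → ℤ × ℤ} (h1 : (ptC (f 1)).arg = π / 4) {k : ℕ} (hk : 1 ≤ k)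
    (hf : ∀ j, 1 ≤ j → j ≤ k → InCone (f j)) : angleSum f k = (ptC (f k)).arg - π / 4 := by
  induction k, hk using Nat.le_induction with
  | base => simp [angleSum, h1]
  | succ k hk ih =>
    have hf₁ := hf k hk (by omega)
    have hf₂ := hf (k + 1) (by omega) le_rfl
    have hm₁ := (inCone_iff_arg hf₁.ne_zero).1 hf₁
    have hm₂ := (inCone_iff_arg hf₂.ne_zero).1 hf₂
    have : (ptC (f (k + 1)) / ptC (f k)).arg = (ptC (f (k + 1))).arg - (ptC (f k)).arg := by
      refine eq_of_coe_angle_eq ?_ (arg_mem_Ioc _) ?_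
      · rw [arg_div_coe_angle (ptC_ne_zero hf₂.ne_zero) (ptC_ne_zero hf₁.ne_zero),
          Real.Angle.coe_sub]
      · constructor <;> linarith [hm₁.1, hm₁.2, hm₂.1, hm₂.2, pi_pos]
    rw [angleSum_succ f hk, ih fun j h h' => hf j h (by omega), this]
    ring

theorem inCone_iff_angleSum {f : ℕ → ℤ × ℤ} (h1 : f 1 = (1, 1)) {k : ℕ}
    (hf : ∀ j, 1 ≤ j → j ≤ k → f j ≠ (0, 0)) :
    (∀ j, 1 ≤ j → j ≤ k → InCone (f j)) ↔
      ∀ j, 1 ≤ j → j ≤ k → angleSum f j ∈ Ioo (-(π / 4)) (π / 2) := by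
  have hc1 : InCone (f 1) := by simp [h1, InCone]
  have ha1 : (ptC (f 1)).arg = π / 4 := by
    rw [← eq_one_one_iff hc1 (by simp [h1, IsDiagStep])]
    exact h1
  have hio : ∀ x : ℝ, x - π / 4 ∈ Ioo (-(π / 4)) (π / 2) ↔ x ∈ Ioo 0 (3 * π / 4) := fun x => by
    simp only [mem_Ioo]
    constructor <;> rintro ⟨h, h'⟩ <;> constructor <;> linarith
  constructor
  · intro h j hj hjk
    rw [angleSum_eq ha1 hj fun i hi hij => h i hi (by omega), hio]
    exact (inCone_iff_arg (hf j hj hjk)).1 (h j hj hjk)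
  · intro h j hj hjk
    induction j using Nat.strong_induction_on with
    | _ j ih =>
      obtain rfl | hj' := hj.eq_or_lt
      · exact hc1
      · obtain ⟨i, rfl⟩ : ∃ i, j = i + 1 := ⟨j - 1, by omega⟩
        have hi : 1 ≤ i := by omega
        have hsum := angleSum_eq ha1 hi fun i' h₁ h₂ => ih i' (by omega) h₁ (by omega)
        have hmem := h (i + 1) hj hjk
        have h₁ := hf i hi (by omega)
        have h₂ := hf (i + 1) hj hjk
        have e : angleSum f (i + 1) = (ptC (f (i + 1))).arg - π / 4 := by
          have : angleSum f (i + 1) + π / 4 = (ptC (f (i + 1))).arg := by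
            refine eq_of_coe_angle_eq ?_ ?_ (arg_mem_Ioc _)
            · rw [angleSum_succ f hi, hsum, sub_add_eq_add_sub, sub_add_cancel, Real.Angle.coe_add,
                arg_div_coe_angle (ptC_ne_zero h₂) (ptC_ne_zero h₁)]
              abel
            · constructor <;> linarith [hmem.1, hmem.2, pi_pos]
          linarith
        rw [e, hio] at hmem
        exact (inCone_iff_arg h₂).2 hmem

/-- The closed walk obtained from `l` by adding a first and a last step at the origin. -/
def closeUp (l : List (ℤ × ℤ)) : List (ℤ × ℤ) := (0, 0) :: (l ++ [(0, 0)])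

theorem closeUp_injective : Function.Injective closeUp := fun _ _ h =>
  List.append_left_injective _ (List.cons_injective h)

theorem length_closeUp (l : List (ℤ × ℤ)) : (closeUp l).length = l.length + 2 := by
  simp [closeUp]

theorem exists_closeUp {w : List (ℤ × ℤ)} (h2 : 2 ≤ w.length) (hh : w.head? = some (0, 0))
    (hl : w.getLast? = some (0, 0)) : ∃ l, w = closeUp l := by
  rcases w with _ | ⟨a, w⟩
  · simp at h2
  have hw : w ≠ [] := by rintro rfl; simp at h2
  rw [List.getLast?_cons_of_ne_nil hw, List.getLast?_eq_some_iff] at hl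
  obtain ⟨l, rfl⟩ := hl
  simp only [List.head?_cons, Option.some.injEq] at hh
  exact ⟨l, by rw [hh, closeUp]⟩

theorem getD_closeUp {l : List (ℤ × ℤ)} {j : ℕ} (hj : j < l.length) :
    (closeUp l).getD (j + 1) 0 = l[j] := by
  rw [closeUp, List.getD_cons_succ, List.getD_append _ _ _ _ hj, List.getD_eq_getElem _ _ hj]

theorem forall_getD_closeUp {l : List (ℤ × ℤ)} {P : ℤ × ℤ → Prop} :
    (∀ i, 1 ≤ i → i ≤ l.length → P ((closeUp l).getD i 0)) ↔ ∀ x ∈ l, P x := by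
  constructor
  · intro h x hx
    obtain ⟨i, hi, rfl⟩ := List.mem_iff_getElem.1 hx
    rw [← getD_closeUp hi]
    exact h (i + 1) (by omega) hi
  · intro h i hi hil
    obtain ⟨j, rfl⟩ : ∃ j, i = j + 1 := ⟨i - 1, by omega⟩
    rw [getD_closeUp hil]
    exact h _ (List.getElem_mem _)

theorem windExcTo_closeUp (l : List (ℤ × ℤ)) (i : ℕ) :
    windExcTo (closeUp l) i = angleSum (fun i => (closeUp l).getD i 0) (min i l.length) := by
  rw [windExcTo, angleSum, length_closeUp, Nat.add_sub_cancel]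

theorem isChain_closeUp {l : List (ℤ × ℤ)} {a b : ℤ × ℤ} (ha : l.head? = some a)
    (hb : l.getLast? = some b) :
    (closeUp l).IsChain IsDiagStep ↔
      IsDiagStep (0, 0) a ∧ l.IsChain IsDiagStep ∧ IsDiagStep b (0, 0) := by
  rw [closeUp, List.isChain_cons, List.isChain_append]
  simp [ha, hb, List.head?_append]

/-- Adding steps at the origin identifies walks in the cone with the excursions of Gessel's
conjecture. -/
theorem gessel_excursion_iff (n : ℕ) (w : List (ℤ × ℤ)) :
    w ∈ (coneWalks (2 * n) (1, 1)).map ⟨closeUp, closeUp_injective⟩ ↔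
      IsExcursion w ∧ w.length - 1 = 2 * n + 2 ∧ w.getD 1 0 = (1, 1) ∧ windExc w = 0 ∧
        ∀ i ≤ w.length - 1, windExcTo w i ∈ Set.Ioo (-(π / 4)) (π / 2) := by
  have hiff : ∀ l : List (ℤ × ℤ), l.length = 2 * n + 1 →
      (l ∈ coneWalks (2 * n) (1, 1) ↔ IsExcursion (closeUp l) ∧
        (closeUp l).getD 1 0 = (1, 1) ∧ windExc (closeUp l) = 0 ∧
        ∀ i ≤ (closeUp l).length - 1, windExcTo (closeUp l) i ∈ Set.Ioo (-(π / 4)) (π / 2)) := by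
    intro l hlen
    obtain ⟨f, hf⟩ : ∃ f, f = fun i => (closeUp l).getD i 0 := ⟨_, rfl⟩
    have hfirst : l.head? = some (f 1) := by
      rw [hf]
      simp only
      rw [← zero_add 1, getD_closeUp (by omega), List.head?_eq_getElem?, List.getElem?_eq_getElem]
    have hlast : l.getLast? = some (f l.length) := by
      obtain ⟨k, hk⟩ : ∃ k, l.length = k + 1 := ⟨_, hlen⟩
      rw [hf, hk]
      simp only
      rw [getD_closeUp (by omega), List.getLast?_eq_getElem?, show l.length - 1 = k by omega,
        List.getElem?_eq_getElem]
    have hwind : windExc (closeUp l) = angleSum f l.length := by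
      rw [windExc, windExcTo_closeUp, length_closeUp, ← hf]
      congr 1
      omega
    have hlen1 : 1 ≤ l.length := by omega
    have hbound : (∀ i ≤ (closeUp l).length - 1,
        windExcTo (closeUp l) i ∈ Set.Ioo (-(π / 4)) (π / 2)) ↔
        ∀ i, 1 ≤ i → i ≤ l.length → angleSum f i ∈ Set.Ioo (-(π / 4)) (π / 2) := by
      simp only [windExcTo_closeUp, ← hf, length_closeUp]
      constructor
      · intro h i _ hi
        simpa [hi] using h i (by omega)
      · intro h i _
        rcases Nat.eq_zero_or_pos i with rfl | hi
        · simp [angleSum, pi_pos]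
        · exact h _ (by omega) (by omega)
    have hcone : (∀ i, 1 ≤ i → i ≤ l.length → InCone (f i)) ↔ ∀ x ∈ l, InCone x := by
      rw [hf]; exact forall_getD_closeUp
    have hexc : IsExcursion (closeUp l) ↔ (closeUp l).IsChain IsDiagStep ∧
        ∀ i, 1 ≤ i → i ≤ l.length → f i ≠ (0, 0) := by
      rw [hf]
      simp only [IsExcursion, length_closeUp, Nat.add_sub_cancel]
      constructor
      · rintro ⟨-, h, -, -, h'⟩
        exact ⟨h, h'⟩
      · rintro ⟨h, h'⟩
        exact ⟨by omega, h, by simp [closeUp],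
          List.getLast?_eq_some_iff.2 ⟨(0, 0) :: l, rfl⟩, h'⟩
    have hf1 : (closeUp l).getD 1 0 = f 1 := by rw [hf]
    rw [mem_coneWalks, hexc, isChain_closeUp hfirst hlast, hbound, hwind, hf1, hfirst, hlast,
      Option.some.injEq, Option.some.injEq, ← hcone]
    have hlastCone : ∀ h1 : f 1 = (1, 1), (∀ i, 1 ≤ i → i ≤ l.length → InCone (f i)) →
        IsDiagStep (f l.length) (0, 0) → (f l.length = (1, 1) ↔ angleSum f l.length = 0) := by
      intro h1 hc hs
      have hc1 : InCone (1, 1) := by simp [InCone]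
      have ha1 : (ptC (f 1)).arg = π / 4 := by
        rw [h1]
        exact (eq_one_one_iff hc1 (by simp [IsDiagStep])).1 rfl
      rw [eq_one_one_iff (hc _ hlen1 le_rfl) hs, angleSum_eq ha1 hlen1 hc, sub_eq_zero]
    constructor
    · rintro ⟨-, h1, h2, h3, h4⟩
      have hs : IsDiagStep (f l.length) (0, 0) := by simp [h2, IsDiagStep]
      have h0 : ∀ i, 1 ≤ i → i ≤ l.length → f i ≠ (0, 0) := fun i hi hi' => (h4 i hi hi').ne_zero
      exact ⟨⟨⟨by simp [h1, IsDiagStep], h3, hs⟩, h0⟩, h1, (hlastCone h1 h4 hs).1 h2,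
        (inCone_iff_angleSum h1 h0).1 h4⟩
    · rintro ⟨⟨⟨-, h3, hs⟩, h0⟩, h1, h2, h4⟩
      have h4' := (inCone_iff_angleSum h1 h0).2 h4
      exact ⟨hlen, h1, (hlastCone h1 h4' hs).2 h2, h3, h4'⟩
  simp only [Finset.mem_map, Function.Embedding.coeFn_mk]
  constructor
  · rintro ⟨l, hl, rfl⟩
    have hlen := ((mem_coneWalks _ _ _).1 hl).1
    obtain ⟨h1, h2⟩ := (hiff l hlen).1 hl
    exact ⟨h1, by rw [length_closeUp]; omega, h2⟩
  · rintro ⟨h1, hlen, h2⟩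
    obtain ⟨l, rfl⟩ := exists_closeUp h1.1 h1.2.2.1 h1.2.2.2.1
    rw [length_closeUp] at hlen
    exact ⟨l, (hiff l (by omega)).2 ⟨h1, h2⟩, rfl⟩

end Gessel

/-- Corollary 17 (Gessel's lattice path conjecture): the number of excursions of length
`2n+2` with first step `(1,1)`, winding angle `0`, and winding angle sequence staying in
`(-π/4, π/2)`, equals `16ⁿ (5/6)_n (1/2)_n / ((2)_n (5/3)_n)`. -/
theorem statement15 (n : ℕ) :
    (Nat.card {w : List (ℤ × ℤ) // IsExcursion w ∧ w.length - 1 = 2 * n + 2 ∧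
        w.getD 1 0 = (1, 1) ∧ windExc w = 0 ∧
        ∀ i ≤ w.length - 1, windExcTo w i ∈ Set.Ioo (-(π / 4)) (π / 2)} : ℝ) =
      16 ^ n * (poch (5 / 6) n * poch (1 / 2) n) / (poch 2 n * poch (5 / 3) n) := by
  rw [Nat.subtype_card _ (Gessel.gessel_excursion_iff n), Finset.card_map, ← Gessel.numWalks_eq,
    ← Gessel.card_coneWalks]
  simp

end
end
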